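/- Assume condition (9), let ℓ_1, …, ℓ_p ≥ 0 be integers, set R(k_1, …, k_p) = P(k_1, …, k_p)/((k_1+r_1)_{n_1+1}^{A_1} ⋯ (k_p+r_p)_{n_p+1}^{A_p}), and assume that the series Σ_{k_1 ≥ … ≥ k_p ≥ 1} (∂/∂k_1)^{ℓ_1} ⋯ (∂/∂k_p)^{ℓ_p} R(k_1, …, k_p) converges. Then this series is a K-linear combination of multiple zeta values of depth at most p in which every multiple zeta value ζ(s_1, …, s_p) of depth exactly p appearing with a nonzero coefficient satisfies s_1 ≥ 2 and 1 + ℓ_i ≤ s_i ≤ A_i + ℓ_i for every i ∈ {1, …, p}. -/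

import Mathlib

/-- The multiple zeta value `ζ(s₁, …, s_q)`, defined as a sum over strictly
decreasing tuples `k₁ > k₂ > … > k_q ≥ 1`.  For the empty list it equals `1`. -/
noncomputable def mzv (s : List ℕ) : ℝ :=
  ∑' k : {k : Fin s.length → ℕ // StrictAnti k ∧ ∀ i, 1 ≤ k i},
    ∏ i : Fin s.length, ((k.1 i : ℝ) ^ s.get i)⁻¹

/-- The rational function `P(k₁,…,k_p) / ∏ᵢ ((kᵢ+rᵢ)_{nᵢ+1})^{Aᵢ}`. -/
noncomputable def Rfun (p : ℕ) (K : Subfield ℂ) (A n r : ℕ → ℕ)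
    (P : MvPolynomial (Fin p) K) (k : Fin p → ℂ) : ℂ :=
  MvPolynomial.eval₂ K.subtype k P /
    ∏ i : Fin p, ((ascPochhammer ℂ (n i.1 + 1)).eval (k i + (r i.1 : ℂ))) ^ A i.1

/-- The `m`-th partial derivative `(∂/∂kᵢ)^m F` of a function of `p` complex
variables. -/
noncomputable def pderivIter (p : ℕ) (i : Fin p) (m : ℕ)
    (F : (Fin p → ℂ) → ℂ) : (Fin p → ℂ) → ℂ :=
  fun k => iteratedDeriv m (fun z => F (Function.update k i z)) (k i)

/-- The iterated partial derivative `(∂/∂k₁)^{l₁} ⋯ (∂/∂k_p)^{l_p} F`. -/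
noncomputable def pderivAll (p : ℕ) (l : Fin p → ℕ)
    (F : (Fin p → ℂ) → ℂ) : (Fin p → ℂ) → ℂ :=
  (List.ofFn fun i : Fin p => pderivIter p i (l i)).foldr (fun d g => d g) F

open Filter Topology

/-- The nested sum `∑ f₁(m₁) f₂(m₂) ⋯` over `m₁ < N`, `m₂ < m₁ + e`, `m₃ < m₂ + e`, …; the
indices decrease strictly for `e = 0` and weakly for `e = 1`. -/
noncomputable def nestedSum (e : ℕ) : List (ℕ → ℂ) → ℕ → ℂ
  | [], _ => 1
  | f :: L, N => ∑ m ∈ Finset.range N, f m * nestedSum e L (m + e)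

@[simp] lemma nestedSum_nil (e N : ℕ) : nestedSum e [] N = 1 := rfl

lemma nestedSum_cons (e : ℕ) (f : ℕ → ℂ) (L : List (ℕ → ℂ)) (N : ℕ) :
    nestedSum e (f :: L) N = ∑ m ∈ Finset.range N, f m * nestedSum e L (m + e) := rfl

lemma nestedSum_append_lincomb (e : ℕ) (c : ℂ) {X Y Z : List (ℕ → ℂ)}
    (h : ∀ N, nestedSum e X N = nestedSum e Y N + c * nestedSum e Z N)
    (pre : List (ℕ → ℂ)) (N : ℕ) :
    nestedSum e (pre ++ X) N = nestedSum e (pre ++ Y) N + c * nestedSum e (pre ++ Z) N := by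
  induction pre generalizing N with
  | nil => exact h N
  | cons f pre ih =>
    simp only [List.cons_append, nestedSum_cons, ih, Finset.mul_sum, ← Finset.sum_add_distrib]
    exact Finset.sum_congr rfl fun m _ => by ring

lemma nestedSum_telescope_nil (F : ℕ → ℂ) (N : ℕ) :
    nestedSum 1 [fun m => F (m + 1) - F m] N = F N - F 0 := by
  simp only [nestedSum_cons, nestedSum_nil, mul_one, Finset.sum_range_sub]

lemma nestedSum_telescope (F g : ℕ → ℂ) (L : List (ℕ → ℂ)) (N : ℕ) :
    nestedSum 1 ((fun m => F (m + 1) - F m) :: g :: L) N =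
      F N * nestedSum 1 (g :: L) N - nestedSum 1 ((F * g) :: L) N := by
  induction N with
  | zero => simp [nestedSum_cons]
  | succ N ih =>
    rw [nestedSum_cons] at ih ⊢
    rw [Finset.sum_range_succ, ih, nestedSum_cons 1 g, nestedSum_cons 1 g,
      nestedSum_cons 1 (F * g), nestedSum_cons 1 (F * g), Finset.sum_range_succ,
      Finset.sum_range_succ]
    simp only [Pi.mul_apply]
    ring

lemma nestedSum_cons_telescope_nil (h F : ℕ → ℂ) (N : ℕ) :
    nestedSum 1 [h, fun m => F (m + 1) - F m] N =
      nestedSum 1 [fun m => h m * F (m + 1)] N + (-F 0) * nestedSum 1 [h] N := by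
  rw [nestedSum_cons, nestedSum_cons, nestedSum_cons, Finset.mul_sum, ← Finset.sum_add_distrib]
  refine Finset.sum_congr rfl fun m _ => ?_
  rw [nestedSum_telescope_nil]
  simp only [nestedSum_nil]
  ring

lemma nestedSum_cons_telescope (h F g : ℕ → ℂ) (L : List (ℕ → ℂ)) (N : ℕ) :
    nestedSum 1 (h :: (fun m => F (m + 1) - F m) :: g :: L) N =
      nestedSum 1 ((fun m => h m * F (m + 1)) :: g :: L) N +
        (-1) * nestedSum 1 (h :: (F * g) :: L) N := by
  rw [nestedSum_cons, nestedSum_cons, nestedSum_cons, Finset.mul_sum, ← Finset.sum_add_distrib]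
  refine Finset.sum_congr rfl fun m _ => ?_
  rw [nestedSum_telescope]
  ring

/-- The nested sum over weakly decreasing indices converges to an element of `W`. -/
def LimIn {K : Subfield ℂ} (W : Submodule K ℂ) (L : List (ℕ → ℂ)) : Prop :=
  ∃ x ∈ W, Tendsto (nestedSum 1 L) atTop (𝓝 x)

section LimIn

variable {K : Subfield ℂ} {W W' : Submodule K ℂ}

lemma LimIn.mono (hW : W ≤ W') {L : List (ℕ → ℂ)} (h : LimIn W L) : LimIn W' L :=
  let ⟨x, hx, hL⟩ := h
  ⟨x, hW hx, hL⟩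

lemma LimIn.lincomb (c : K) {X Y Z : List (ℕ → ℂ)}
    (h : ∀ N, nestedSum 1 X N = nestedSum 1 Y N + (c : ℂ) * nestedSum 1 Z N)
    (hY : LimIn W Y) (hZ : LimIn W Z) : LimIn W X := by
  obtain ⟨y, hy, hY⟩ := hY
  obtain ⟨z, hz, hZ⟩ := hZ
  refine ⟨y + (c : ℂ) * z, W.add_mem hy ?_, ?_⟩
  · simpa [Subfield.smul_def] using W.smul_mem c hz
  · exact (hY.add (hZ.const_mul _)).congr fun N => (h N).symm

lemma LimIn.of_mem_span {G : Set (ℕ → ℂ)} {pre post : List (ℕ → ℂ)}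
    (H : ∀ f ∈ G, LimIn W (pre ++ f :: post)) {f : ℕ → ℂ} (hf : f ∈ Submodule.span K G) :
    LimIn W (pre ++ f :: post) := by
  induction hf using Submodule.span_induction with
  | mem f hf => exact H f hf
  | zero =>
    refine ⟨0, W.zero_mem, tendsto_const_nhds.congr fun N => ?_⟩
    have h : ∀ N, nestedSum 1 (0 :: post) N =
        nestedSum 1 (0 :: post) N + (-1) * nestedSum 1 (0 :: post) N := by
      simp [nestedSum_cons]
    rw [nestedSum_append_lincomb 1 _ h pre N]
    ring
  | add f g _ _ hf hg =>
    refine LimIn.lincomb 1 (fun N => ?_) hf hg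
    refine nestedSum_append_lincomb 1 _ (fun N => ?_) pre N
    simp [nestedSum_cons, add_mul, Finset.sum_add_distrib]
  | smul c f _ hf =>
    refine LimIn.lincomb (c - 1) (fun N => ?_) hf hf
    refine nestedSum_append_lincomb 1 _ (fun N => ?_) pre N
    simp only [nestedSum_cons, Finset.mul_sum, ← Finset.sum_add_distrib]
    refine Finset.sum_congr rfl fun m _ => ?_
    simp only [Pi.smul_apply, Subfield.smul_def, smul_eq_mul]
    push_cast
    ring

lemma LimIn.of_forall₂_span {α : Type*} {G : α → Set (ℕ → ℂ)}
    (q : List α) (pre : List (ℕ → ℂ))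
    (H : ∀ L, List.Forall₂ (fun f a => f ∈ G a) L q → LimIn W (pre ++ L)) :
    ∀ L, List.Forall₂ (fun f a => f ∈ Submodule.span K (G a)) L q → LimIn W (pre ++ L) := by
  induction q generalizing pre with
  | nil =>
    rintro _ ⟨⟩
    exact H [] .nil
  | cons a q ih =>
    rintro _ (_ | ⟨hf, hL⟩)
    refine LimIn.of_mem_span (fun g hg => ?_) hf
    have := ih (pre ++ [g]) (fun L' hL' => by simpa using H (g :: L') (.cons hg hL')) _ hL
    simpa using this

end LimIn

/-- The rational function `z ^ a / ∏_{j ∈ M} (z + j)`. -/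
noncomputable def ratGen (a : ℕ) (M : Multiset ℕ) (z : ℂ) : ℂ :=
  z ^ a * ((M.map fun j : ℕ => z + (j : ℂ)).prod)⁻¹

lemma ratGen_zero_right (a : ℕ) (z : ℂ) : ratGen a 0 z = z ^ a := by simp [ratGen]

lemma ratGen_cons (a j : ℕ) (M : Multiset ℕ) (z : ℂ) :
    ratGen a (j ::ₘ M) z = ratGen a M z * (z + j)⁻¹ := by
  simp only [ratGen, Multiset.map_cons, Multiset.prod_cons, mul_inv]
  ring

lemma ratGen_succ (a : ℕ) (M : Multiset ℕ) (z : ℂ) :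
    ratGen (a + 1) M z = z * ratGen a M z := by
  simp only [ratGen]
  ring

lemma ratGen_mul (a b : ℕ) (M M' : Multiset ℕ) (z : ℂ) :
    ratGen a M z * ratGen b M' z = ratGen (a + b) (M + M') z := by
  simp only [ratGen, Multiset.map_add, Multiset.prod_add, mul_inv]
  ring

lemma ratGen_replicate (s j : ℕ) (z : ℂ) :
    ratGen 0 (Multiset.replicate s j) z = ((z + j) ^ s)⁻¹ := by
  simp [ratGen]

lemma add_natCast_ne_zero {z : ℂ} (hz : 0 < z.re) (j : ℕ) : z + j ≠ 0 := by
  intro h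
  have := congrArg Complex.re h
  simp only [Complex.add_re, Complex.natCast_re, Complex.zero_re] at this
  have : (0 : ℝ) ≤ j := j.cast_nonneg
  linarith

lemma analyticAt_ratGen (a : ℕ) (M : Multiset ℕ) {z : ℂ} (hz : 0 < z.re) :
    AnalyticAt ℂ (ratGen a M) z := by
  induction M using Multiset.induction_on with
  | empty =>
    rw [show ratGen a 0 = fun z => z ^ a from funext (ratGen_zero_right a)]
    fun_prop
  | cons j M ih =>
    rw [show ratGen a (j ::ₘ M) = fun z => ratGen a M z * (z + j)⁻¹ from
      funext (ratGen_cons a j M)]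
    exact ih.mul ((analyticAt_id.add analyticAt_const).inv (add_natCast_ne_zero hz j))

/-- Functions vanishing on the right half-plane. -/
def vanishingSet : Set (ℂ → ℂ) := {h | ∀ z : ℂ, 0 < z.re → h z = 0}

lemma eventually_re_pos {z : ℂ} (hz : 0 < z.re) : ∀ᶠ w in 𝓝 z, 0 < w.re :=
  Complex.continuous_re.continuousAt.eventually (lt_mem_nhds hz)

lemma mem_span_union_vanishing_congr {K : Subfield ℂ} {G : Set (ℂ → ℂ)} {h h' : ℂ → ℂ}
    (hh : h ∈ Submodule.span K (G ∪ vanishingSet)) (heq : ∀ z : ℂ, 0 < z.re → h' z = h z) :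
    h' ∈ Submodule.span K (G ∪ vanishingSet) := by
  rw [← sub_add_cancel h' h]
  refine Submodule.add_mem _ (Submodule.subset_span (.inr fun z hz => ?_)) hh
  simp [heq z hz]

lemma analyticAt_of_mem_span {K : Subfield ℂ} {G : Set (ℂ → ℂ)}
    (hG : ∀ g ∈ G, ∀ z : ℂ, 0 < z.re → AnalyticAt ℂ g z) {h : ℂ → ℂ}
    (hh : h ∈ Submodule.span K (G ∪ vanishingSet)) {z : ℂ} (hz : 0 < z.re) :
    AnalyticAt ℂ h z := by
  induction hh using Submodule.span_induction with
  | mem g hg =>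
    rcases hg with hg | hg
    · exact hG g hg z hz
    · refine analyticAt_const (v := (0 : ℂ)) |>.congr ?_
      filter_upwards [eventually_re_pos hz] with w hw using (hg w hw).symm
  | zero => exact analyticAt_const
  | add f g _ _ hf hg => exact hf.add hg
  | smul c f _ hf =>
    rw [show c • f = fun w => (c : ℂ) * f w from rfl]
    exact analyticAt_const.mul hf

/-- The values of the `ℓ`-th derivative of `h` at the positive integers. -/
noncomputable def derivSeq (ℓ : ℕ) (h : ℂ → ℂ) (m : ℕ) : ℂ := iteratedDeriv ℓ h ((m : ℂ) + 1)

lemma natCast_add_one_re_pos (m : ℕ) : 0 < ((m : ℂ) + 1).re := by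
  simp only [Complex.add_re, Complex.natCast_re, Complex.one_re]
  positivity

lemma derivSeq_mem_span {K : Subfield ℂ} (ℓ : ℕ) {G : Set (ℂ → ℂ)}
    (hG : ∀ g ∈ G, ∀ z : ℂ, 0 < z.re → AnalyticAt ℂ g z) {h : ℂ → ℂ}
    (hh : h ∈ Submodule.span K (G ∪ vanishingSet)) :
    derivSeq ℓ h ∈ Submodule.span K (derivSeq ℓ '' G) := by
  have han : ∀ {f : ℂ → ℂ}, f ∈ Submodule.span K (G ∪ vanishingSet) → ∀ m : ℕ,
      ContDiffAt ℂ ℓ f ((m : ℂ) + 1) := fun hf m =>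
    (analyticAt_of_mem_span hG hf (natCast_add_one_re_pos m)).contDiffAt
  induction hh using Submodule.span_induction with
  | mem g hg =>
    rcases hg with hg | hg
    · exact Submodule.subset_span ⟨g, hg, rfl⟩
    · have : derivSeq ℓ g = 0 := by
        funext m
        have h0 : g =ᶠ[𝓝 ((m : ℂ) + 1)] fun _ => 0 := by
          filter_upwards [eventually_re_pos (natCast_add_one_re_pos m)] with w hw using hg w hw
        simp [derivSeq, h0.iteratedDeriv_eq ℓ]
      rw [this]
      exact Submodule.zero_mem _
  | zero =>
    have : derivSeq ℓ 0 = 0 := by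
      funext m
      simp only [derivSeq, Pi.zero_apply]
      rw [show (0 : ℂ → ℂ) = fun _ => 0 from rfl, iteratedDeriv_const]
      simp
    rw [this]
    exact Submodule.zero_mem _
  | add f g hf hg ihf ihg =>
    have : derivSeq ℓ (f + g) = derivSeq ℓ f + derivSeq ℓ g :=
      funext fun m => iteratedDeriv_add (han hf m) (han hg m)
    rw [this]
    exact Submodule.add_mem _ ihf ihg
  | smul c f hf ih =>
    have : derivSeq ℓ (c • f) = c • derivSeq ℓ f :=
      funext fun m => iteratedDeriv_const_smul (han hf m) c
    rw [this]
    exact Submodule.smul_mem _ c ih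

/-- The generators `z ^ a / ∏_{j ∈ M} (z + j)` of degree at most `d`. -/
def ratGens (d : ℤ) : Set (ℂ → ℂ) :=
  {h | ∃ (a : ℕ) (M : Multiset ℕ), (a : ℤ) - M.card ≤ d ∧ h = ratGen a M}

/-- Functions agreeing on the right half-plane with a rational function of degree at most `d`
over `K` whose poles are nonpositive integers. -/
noncomputable def ratFil (K : Subfield ℂ) (d : ℤ) : Submodule K (ℂ → ℂ) :=
  Submodule.span K (ratGens d ∪ vanishingSet)

/-- The sequences of values at the positive integers of the elements of `ratFil K d`. -/
noncomputable def seqFil (K : Subfield ℂ) (d : ℤ) : Submodule K (ℕ → ℂ) :=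
  (ratFil K d).map (LinearMap.funLeft K ℂ fun m : ℕ => (m : ℂ) + 1)

section Filtration

variable {K : Subfield ℂ} {d e : ℤ}

lemma mem_seqFil {f : ℕ → ℂ} :
    f ∈ seqFil K d ↔ ∃ h ∈ ratFil K d, (fun m : ℕ => h ((m : ℂ) + 1)) = f := Iff.rfl

lemma ratGen_mem_ratFil {a : ℕ} {M : Multiset ℕ} (h : (a : ℤ) - M.card ≤ d) :
    ratGen a M ∈ ratFil K d :=
  Submodule.subset_span (.inl ⟨a, M, h, rfl⟩)

lemma ratFil_mono (hde : d ≤ e) : ratFil K d ≤ ratFil K e := by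
  refine Submodule.span_mono (Set.union_subset_union_left _ ?_)
  rintro _ ⟨a, M, h, rfl⟩
  exact ⟨a, M, h.trans hde, rfl⟩

lemma seqFil_mono (hde : d ≤ e) : seqFil K d ≤ seqFil K e :=
  Submodule.map_mono (ratFil_mono hde)

lemma analyticAt_of_mem_ratGens : ∀ g ∈ ratGens d, ∀ z : ℂ, 0 < z.re → AnalyticAt ℂ g z := by
  rintro _ ⟨a, M, -, rfl⟩ z hz
  exact analyticAt_ratGen a M hz

lemma ratFil_mul {h h' : ℂ → ℂ} (hh : h ∈ ratFil K d) (hh' : h' ∈ ratFil K e) :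
    h * h' ∈ ratFil K (d + e) := by
  have := Submodule.mul_mem_mul hh hh'
  rw [ratFil, ratFil, Submodule.span_mul_span] at this
  refine Submodule.span_le.2 ?_ this
  rintro _ ⟨f, hf, g, hg, rfl⟩
  rcases hf with ⟨a, M, ha, rfl⟩ | hf
  · rcases hg with ⟨b, M', hb, rfl⟩ | hg
    · refine Submodule.subset_span (.inl ⟨a + b, M + M', ?_, ?_⟩)
      · simp only [Multiset.card_add]
        push_cast
        linarith
      · exact funext fun z => ratGen_mul a b M M' z
    · exact Submodule.subset_span (.inr fun z hz => by simp [hg z hz])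
  · exact Submodule.subset_span (.inr fun z hz => by simp [hf z hz])

lemma seqFil_mul {f g : ℕ → ℂ} (hf : f ∈ seqFil K d) (hg : g ∈ seqFil K e) :
    f * g ∈ seqFil K (d + e) := by
  obtain ⟨h, hh, rfl⟩ := hf
  obtain ⟨h', hh', rfl⟩ := hg
  exact ⟨h * h', ratFil_mul hh hh', rfl⟩

lemma ratFil_shift {h : ℂ → ℂ} (hh : h ∈ ratFil K d) : (fun z => h (z + 1)) ∈ ratFil K d := by
  have key : ratFil K d ≤ (ratFil K d).comap (LinearMap.funLeft K ℂ fun z : ℂ => z + 1) := by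
    refine Submodule.span_le.2 ?_
    rintro g (⟨a, M, ha, rfl⟩ | hg)
    · have : (LinearMap.funLeft K ℂ fun z : ℂ => z + 1) (ratGen a M) =
          ∑ b ∈ Finset.range (a + 1), (a.choose b : K) • ratGen b (M.map (· + 1)) := by
        funext z
        simp only [LinearMap.funLeft_apply, ratGen, Finset.sum_apply, Pi.smul_apply, add_pow,
          Subfield.smul_def, smul_eq_mul, Finset.sum_mul, Multiset.map_map, Function.comp_def]
        refine Finset.sum_congr rfl fun b _ => ?_
        have : (fun j : ℕ => z + 1 + (j : ℂ)) = fun j : ℕ => z + ((j + 1 : ℕ) : ℂ) := by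
          funext j
          push_cast
          ring
        rw [this]
        push_cast
        ring
      rw [SetLike.mem_coe, Submodule.mem_comap, this]
      refine Submodule.sum_mem _ fun b hb => Submodule.smul_mem _ _ (ratGen_mem_ratFil ?_)
      have := Finset.mem_range.1 hb
      rw [Multiset.card_map]
      omega
    · refine Submodule.subset_span (.inr fun z hz => hg _ ?_)
      simp only [Complex.add_re, Complex.one_re]
      linarith
  exact key hh

lemma seqFil_shift {f : ℕ → ℂ} (hf : f ∈ seqFil K d) : (fun m => f (m + 1)) ∈ seqFil K d := by
  obtain ⟨h, hh, rfl⟩ := hf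
  refine ⟨_, ratFil_shift hh, funext fun m => ?_⟩
  simp [LinearMap.funLeft_apply]

lemma deriv_ratGen_mem (a : ℕ) (M : Multiset ℕ) :
    deriv (ratGen a M) ∈ ratFil K ((a : ℤ) - M.card) := by
  induction M using Multiset.induction_on with
  | empty =>
    have : deriv (ratGen a 0) = (a : K) • ratGen (a - 1) 0 := by
      funext z
      rw [show ratGen a 0 = fun z => z ^ a from funext (ratGen_zero_right a)]
      simp [ratGen_zero_right, Subfield.smul_def]
    rw [this]
    exact Submodule.smul_mem _ _ (ratGen_mem_ratFil (by simp))
  | cons j M ih =>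
    have hj : ratGen 0 {j} ∈ ratFil K (-1) := ratGen_mem_ratFil (by simp)
    have hjj : ratGen a (j ::ₘ j ::ₘ M) ∈ ratFil K ((a : ℤ) - (j ::ₘ M).card) :=
      ratGen_mem_ratFil (by simp only [Multiset.card_cons]; push_cast; linarith)
    have h := Submodule.sub_mem _ (ratFil_mono (e := (a : ℤ) - (j ::ₘ M).card)
      (by simp only [Multiset.card_cons]; push_cast; linarith) (ratFil_mul ih hj)) hjj
    refine mem_span_union_vanishing_congr h fun z hz => ?_
    rw [show ratGen a (j ::ₘ M) = fun z => ratGen a M z * (z + j)⁻¹ from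
      funext (ratGen_cons a j M)]
    have hd : HasDerivAt (fun w : ℂ => (w + j)⁻¹) (-1 / (z + j) ^ 2) z :=
      ((hasDerivAt_id z).add_const (j : ℂ)).inv (add_natCast_ne_zero hz j)
    rw [((analyticAt_ratGen a M hz).differentiableAt.hasDerivAt.fun_mul hd).deriv]
    have := add_natCast_ne_zero hz j
    have hs : ratGen 0 {j} z = (z + j)⁻¹ := by simp [ratGen]
    simp only [Pi.sub_apply, Pi.mul_apply, ratGen_cons, hs]
    field_simp
    ring

lemma deriv_mem_ratFil {h : ℂ → ℂ} (hh : h ∈ ratFil K d) : deriv h ∈ ratFil K d := by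
  induction hh using Submodule.span_induction with
  | mem g hg =>
    rcases hg with ⟨a, M, ha, rfl⟩ | hg
    · exact ratFil_mono ha (deriv_ratGen_mem a M)
    · refine Submodule.subset_span (.inr fun z hz => ?_)
      have h0 : g =ᶠ[𝓝 z] fun _ => 0 := by
        filter_upwards [eventually_re_pos hz] with w hw using hg w hw
      simp [h0.deriv_eq]
  | zero => simp [show deriv (0 : ℂ → ℂ) = 0 from funext fun z => deriv_const z 0]
  | add f g hf hg ihf ihg =>
    refine mem_span_union_vanishing_congr (Submodule.add_mem _ ihf ihg) fun z hz => ?_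
    exact deriv_add (analyticAt_of_mem_span analyticAt_of_mem_ratGens hf hz).differentiableAt
      (analyticAt_of_mem_span analyticAt_of_mem_ratGens hg hz).differentiableAt
  | smul c f hf ih =>
    refine mem_span_union_vanishing_congr (Submodule.smul_mem _ c ih) fun z hz => ?_
    exact deriv_const_smul c
      (analyticAt_of_mem_span analyticAt_of_mem_ratGens hf hz).differentiableAt

lemma derivSeq_mem_seqFil (ℓ : ℕ) {h : ℂ → ℂ} (hh : h ∈ ratFil K d) :
    derivSeq ℓ h ∈ seqFil K d := by
  refine ⟨iteratedDeriv ℓ h, ?_, rfl⟩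
  induction ℓ with
  | zero => simpa using hh
  | succ ℓ ih =>
    rw [iteratedDeriv_succ]
    exact deriv_mem_ratFil ih

lemma seqFil_le_span : seqFil K d ≤ Submodule.span K (derivSeq 0 '' ratGens d) := by
  rintro _ ⟨h, hh, rfl⟩
  exact derivSeq_mem_span 0 analyticAt_of_mem_ratGens hh

end Filtration

/-- The sequence `m ↦ (m + 1 + j) ^ (-s)`. -/
noncomputable def powSeq (s j m : ℕ) : ℂ := (((m : ℂ) + 1 + j) ^ s)⁻¹

/-- Forward differences of the elements of `seqFil K (d + 1)`. -/
noncomputable def teleSub (K : Subfield ℂ) (d : ℤ) : Submodule K (ℕ → ℂ) :=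
  (seqFil K (d + 1)).map (LinearMap.funLeft K ℂ (· + 1) - LinearMap.id)

section PartialFractions

variable {K : Subfield ℂ} {d e : ℤ}

lemma mem_teleSub {f : ℕ → ℂ} :
    f ∈ teleSub K d ↔ ∃ F ∈ seqFil K (d + 1), (fun m => F (m + 1) - F m) = f := Iff.rfl

lemma teleSub_mono (hde : d ≤ e) : teleSub K d ≤ teleSub K e :=
  Submodule.map_mono (seqFil_mono (by linarith))

lemma pow_mem_seqFil {a : ℕ} (h : (a : ℤ) ≤ d) : (fun m : ℕ => ((m : ℂ) + 1) ^ a) ∈ seqFil K d :=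
  ⟨ratGen a 0, ratGen_mem_ratFil (by simpa using h), funext fun _ => ratGen_zero_right a _⟩

lemma pow_mem_teleSub (a : ℕ) : (fun m : ℕ => ((m : ℂ) + 1) ^ a) ∈ teleSub K a := by
  induction a using Nat.strong_induction_on with
  | _ a ih =>
    have h1 : (fun m : ℕ => (((m + 1 : ℕ) : ℂ) + 1) ^ (a + 1) - ((m : ℂ) + 1) ^ (a + 1)) ∈
        teleSub K a :=
      mem_teleSub.2 ⟨_, pow_mem_seqFil (a := a + 1) (by push_cast; rfl), rfl⟩
    have h2 : (fun m : ℕ => ((m : ℂ) + 1) ^ a) = ((a : K) + 1)⁻¹ •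
        ((fun m : ℕ => (((m + 1 : ℕ) : ℂ) + 1) ^ (a + 1) - ((m : ℂ) + 1) ^ (a + 1)) -
        ∑ b ∈ Finset.range a, ((a + 1).choose b : K) • fun m : ℕ => ((m : ℂ) + 1) ^ b) := by
      funext m
      have ha : (a : ℂ) + 1 ≠ 0 := by exact_mod_cast a.succ_ne_zero
      have hx : ((m : ℂ) + 1 + 1) ^ (a + 1) =
          ∑ b ∈ Finset.range a, ((m : ℂ) + 1) ^ b * ((a + 1).choose b : ℂ) +
            ((m : ℂ) + 1) ^ a * (a + 1) + ((m : ℂ) + 1) ^ (a + 1) := by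
        rw [add_pow, Finset.sum_range_succ, Finset.sum_range_succ]
        simp
      simp only [Pi.smul_apply, Pi.sub_apply, Finset.sum_apply, Subfield.smul_def, smul_eq_mul]
      push_cast
      rw [hx]
      simp only [mul_comm (((a + 1).choose _ : ℕ) : ℂ)]
      field_simp
      ring
    rw [h2]
    refine Submodule.smul_mem _ _ (Submodule.sub_mem _ h1 (Submodule.sum_mem _ fun b hb => ?_))
    have hb := Finset.mem_range.1 hb
    exact Submodule.smul_mem _ _ (teleSub_mono (by omega) (ih b hb))

lemma powSeq_eq_ratGen (s j : ℕ) :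
    powSeq s j = fun m : ℕ => ratGen 0 (Multiset.replicate s j) ((m : ℂ) + 1) :=
  funext fun _ => (ratGen_replicate s j _).symm

lemma powSeq_mem_seqFil {s : ℕ} (j : ℕ) (h : -(s : ℤ) ≤ d) : powSeq s j ∈ seqFil K d :=
  ⟨ratGen 0 (Multiset.replicate s j), ratGen_mem_ratFil (by simpa using h),
    (powSeq_eq_ratGen s j).symm⟩

lemma powSeq_sub_mem_teleSub (s j : ℕ) : powSeq s j - powSeq s 0 ∈ teleSub K (-s - 1) := by
  induction j with
  | zero => simp
  | succ j ih =>
    have h : powSeq s (j + 1) - powSeq s j ∈ teleSub K (-s - 1) := by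
      refine mem_teleSub.2 ⟨powSeq s j, powSeq_mem_seqFil j (by simp), funext fun m => ?_⟩
      simp only [powSeq, Pi.sub_apply]
      push_cast
      ring_nf
    simpa using Submodule.add_mem _ h ih

lemma teleSub_le_seqFil : teleSub K d ≤ seqFil K (d + 1) := by
  rintro _ ⟨F, hF, rfl⟩
  exact Submodule.sub_mem _ (seqFil_shift hF) hF

lemma derivSeq_pow_mem_teleSub (ℓ b : ℕ) : derivSeq ℓ (ratGen b 0) ∈ teleSub K b := by
  have : derivSeq ℓ (ratGen b 0) =
      (b.descFactorial ℓ : K) • fun m : ℕ => ((m : ℂ) + 1) ^ (b - ℓ) := by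
    funext m
    rw [derivSeq, show ratGen b 0 = fun z => z ^ b from funext (ratGen_zero_right b)]
    simp [Subfield.smul_def]
  rw [this]
  exact Submodule.smul_mem _ _ (teleSub_mono (by simp) (pow_mem_teleSub (b - ℓ)))

lemma derivSeq_replicate (K : Subfield ℂ) (ℓ s : ℕ) :
    ∃ c : K, ∀ j, derivSeq ℓ (ratGen 0 (Multiset.replicate s j)) = c • powSeq (s + ℓ) j := by
  refine ⟨∏ i ∈ Finset.range ℓ, (((-s : ℤ) : K) - i), fun j => funext fun m => ?_⟩
  rw [derivSeq, show ratGen 0 (Multiset.replicate s j) = fun z : ℂ => (z + j) ^ (-s : ℤ) from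
      funext fun z => by rw [ratGen_replicate]; simp,
    iteratedDeriv_comp_add_const ℓ (fun w : ℂ => w ^ (-s : ℤ)) (j : ℂ)]
  simp only [iteratedDeriv_eq_iterate, iter_deriv_zpow]
  have : (-s : ℤ) - ℓ = -((s + ℓ : ℕ) : ℤ) := by push_cast; ring
  rw [this, zpow_neg, zpow_natCast]
  simp [powSeq, Subfield.smul_def]

lemma ratGen_mem_span_pow_union_frac (a : ℕ) (M : Multiset ℕ) :
    ratGen a M ∈ Submodule.span K (({h | ∃ b : ℕ, (b : ℤ) ≤ a - M.card ∧ h = ratGen b 0} ∪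
      {h | ∃ M' ≤ M, M' ≠ 0 ∧ -(M'.card : ℤ) ≤ a - M.card ∧ h = ratGen 0 M'}) ∪
        vanishingSet) := by
  induction a generalizing M with
  | zero =>
    refine Submodule.subset_span (.inl ?_)
    rcases eq_or_ne M 0 with rfl | hM
    · exact .inl ⟨0, by simp, rfl⟩
    · exact .inr ⟨M, le_rfl, hM, by simp, rfl⟩
  | succ a ih =>
    induction M using Multiset.induction_on with
    | empty => exact Submodule.subset_span (.inl (.inl ⟨a + 1, by simp, rfl⟩))
    | cons j M _ =>
      have h1 := ih M
      have h2 := ih (j ::ₘ M)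
      have hsub : ∀ {M₁ : Multiset ℕ}, M₁ ≤ j ::ₘ M →
          (a : ℤ) - M₁.card ≤ (a + 1 : ℕ) - (j ::ₘ M).card →
          Submodule.span K (({h | ∃ b : ℕ, (b : ℤ) ≤ a - M₁.card ∧ h = ratGen b 0} ∪
            {h | ∃ M' ≤ M₁, M' ≠ 0 ∧ -(M'.card : ℤ) ≤ a - M₁.card ∧ h = ratGen 0 M'}) ∪
              vanishingSet) ≤
          Submodule.span K (({h | ∃ b : ℕ, (b : ℤ) ≤ (a + 1 : ℕ) - (j ::ₘ M).card ∧
            h = ratGen b 0} ∪ {h | ∃ M' ≤ j ::ₘ M, M' ≠ 0 ∧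
              -(M'.card : ℤ) ≤ (a + 1 : ℕ) - (j ::ₘ M).card ∧ h = ratGen 0 M'}) ∪
                vanishingSet) := by
        intro M₁ hM₁ hle
        refine Submodule.span_mono (Set.union_subset_union_left _ (Set.union_subset_union ?_ ?_))
        · rintro _ ⟨b, hb, rfl⟩
          exact ⟨b, hb.trans hle, rfl⟩
        · rintro _ ⟨M', hM', hne, hb, rfl⟩
          exact ⟨M', hM'.trans hM₁, hne, hb.trans hle, rfl⟩
      have h := Submodule.sub_mem _
        (hsub (Multiset.le_cons_self M j) (by rw [Multiset.card_cons]; push_cast; linarith) h1)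
        (Submodule.smul_mem _ (j : K) (hsub le_rfl (by push_cast; linarith) h2))
      refine mem_span_union_vanishing_congr h fun z hz => ?_
      have := add_natCast_ne_zero hz j
      simp only [Pi.sub_apply, Pi.smul_apply, ratGen_succ, ratGen_cons, Subfield.smul_def,
        smul_eq_mul]
      push_cast
      field_simp
      ring

lemma ratGen_mem_span_replicate {A : ℕ} (M : Multiset ℕ) (hM : 2 ≤ M.card)
    (hA : ∀ j, M.count j ≤ A) :
    ratGen 0 M ∈ Submodule.span K (({h | ∃ s j, 2 ≤ s ∧ s ≤ A ∧
      h = ratGen 0 (Multiset.replicate s j)} ∪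
        {h | ∃ i j, h = ratGen 0 (Multiset.replicate 1 i) - ratGen 0 (Multiset.replicate 1 j)}) ∪
          vanishingSet) := by
  induction hn : M.card generalizing M with
  | zero => omega
  | succ n ih =>
    by_cases hrep : ∃ i, M = Multiset.replicate M.card i
    · obtain ⟨i, hi⟩ := hrep
      refine Submodule.subset_span (.inl (.inl ⟨M.card, i, hM, ?_, by rw [← hi]⟩))
      have := hA i
      rwa [hi, Multiset.count_replicate_self] at this
    · obtain ⟨i, hi⟩ := Multiset.card_pos_iff_exists_mem.1 (by omega : 0 < M.card)
      obtain ⟨M₁, rfl⟩ := Multiset.exists_cons_of_mem hi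
      obtain ⟨j, hj, hji⟩ : ∃ j ∈ M₁, j ≠ i := by
        by_contra! h
        refine hrep ⟨i, Multiset.eq_replicate.2 ⟨rfl, fun b hb => ?_⟩⟩
        rcases Multiset.mem_cons.1 hb with rfl | hb
        · rfl
        · exact h b hb
      obtain ⟨M₀, rfl⟩ := Multiset.exists_cons_of_mem hj
      have hsub : ratGen 0 (i ::ₘ M₀) - ratGen 0 (j ::ₘ M₀) ∈
          Submodule.span K (({h | ∃ s j, 2 ≤ s ∧ s ≤ A ∧
            h = ratGen 0 (Multiset.replicate s j)} ∪
              {h | ∃ i j, h = ratGen 0 (Multiset.replicate 1 i) -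
                ratGen 0 (Multiset.replicate 1 j)}) ∪ vanishingSet) := by
        rcases eq_or_ne M₀ 0 with rfl | hM₀
        · exact Submodule.subset_span (.inl (.inr ⟨i, j, rfl⟩))
        · have hc := Multiset.card_pos.2 hM₀
          simp only [Multiset.card_cons] at hn
          refine Submodule.sub_mem _ (ih _ ?_ (fun k => ?_) ?_) (ih _ ?_ (fun k => ?_) ?_)
          · rw [Multiset.card_cons]; omega
          · exact (Multiset.count_le_of_le k
              (Multiset.cons_le_cons i (Multiset.le_cons_self M₀ j))).trans (hA k)
          · rw [Multiset.card_cons]; omega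
          · rw [Multiset.card_cons]; omega
          · exact (Multiset.count_le_of_le k (Multiset.le_cons_self _ i)).trans (hA k)
          · rw [Multiset.card_cons]; omega
      refine mem_span_union_vanishing_congr
        (Submodule.smul_mem _ ((j : K) - i)⁻¹ hsub) fun z hz => ?_
      have h1 := add_natCast_ne_zero hz i
      have h2 := add_natCast_ne_zero hz j
      have h3 : (j : ℂ) - i ≠ 0 := sub_ne_zero.2 (by exact_mod_cast hji)
      simp only [Pi.smul_apply, Pi.sub_apply, ratGen_cons, Subfield.smul_def, smul_eq_mul]
      push_cast
      field_simp
      ring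

end PartialFractions

section Growth

variable {K : Subfield ℂ}

lemma norm_ratGen_le (a : ℕ) (M : Multiset ℕ) (m : ℕ) :
    ‖ratGen a M ((m : ℂ) + 1)‖ ≤ ((m : ℝ) + 1) ^ a * (((m : ℝ) + 1) ^ M.card)⁻¹ := by
  have hm : ‖(m : ℂ) + 1‖ = (m : ℝ) + 1 := by
    rw [← Nat.cast_add_one, Complex.norm_natCast]
    push_cast
    rfl
  induction M using Multiset.induction_on with
  | empty => simp [ratGen_zero_right, hm]
  | cons j M ih =>
    have hj : ‖((m : ℂ) + 1 + j)⁻¹‖ ≤ ((m : ℝ) + 1)⁻¹ := by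
      rw [norm_inv, show (m : ℂ) + 1 + j = ((m + 1 + j : ℕ) : ℂ) by push_cast; rfl,
        Complex.norm_natCast]
      refine inv_anti₀ (by positivity) ?_
      push_cast
      have : (0 : ℝ) ≤ j := j.cast_nonneg
      linarith
    rw [ratGen_cons, norm_mul, Multiset.card_cons, pow_succ, mul_inv, ← mul_assoc]
    exact mul_le_mul ih hj (norm_nonneg _) (by positivity)

lemma norm_le_of_mem_seqFil {f : ℕ → ℂ} (hf : f ∈ seqFil K (-1)) :
    ∃ C : ℝ, 0 ≤ C ∧ ∀ m : ℕ, ‖f m‖ ≤ C * ((m : ℝ) + 1)⁻¹ := by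
  obtain ⟨h, hh, rfl⟩ := hf
  simp only [LinearMap.funLeft_apply]
  induction hh using Submodule.span_induction with
  | mem g hg =>
    rcases hg with ⟨a, M, ha, rfl⟩ | hg
    · refine ⟨1, zero_le_one, fun m => (norm_ratGen_le a M m).trans ?_⟩
      obtain ⟨k, hk⟩ : ∃ k, M.card = a + 1 + k := ⟨M.card - (a + 1), by omega⟩
      have h1 : (1 : ℝ) ≤ ((m : ℝ) + 1) ^ k :=
        one_le_pow₀ (by linarith [(m.cast_nonneg : (0 : ℝ) ≤ m)])
      rw [hk, pow_add, pow_succ, one_mul, mul_inv, mul_inv]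
      have hp : (((m : ℝ) + 1) ^ k)⁻¹ ≤ 1 := inv_le_one_of_one_le₀ h1
      have h2 : ((m : ℝ) + 1) ^ a * ((((m : ℝ) + 1) ^ a)⁻¹ * ((m : ℝ) + 1)⁻¹ *
          (((m : ℝ) + 1) ^ k)⁻¹) = ((m : ℝ) + 1)⁻¹ * (((m : ℝ) + 1) ^ k)⁻¹ := by
        have : ((m : ℝ) + 1) ^ a ≠ 0 := by positivity
        field_simp
      rw [h2]
      exact mul_le_of_le_one_right (by positivity) hp
    · exact ⟨0, le_rfl, fun m => by simp [hg _ (natCast_add_one_re_pos m)]⟩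
  | zero => exact ⟨0, le_rfl, fun m => by simp⟩
  | add f g _ _ hf hg =>
    obtain ⟨C, hC, hf⟩ := hf
    obtain ⟨C', hC', hg⟩ := hg
    refine ⟨C + C', add_nonneg hC hC', fun m => (norm_add_le _ _).trans ?_⟩
    rw [add_mul]
    exact add_le_add (hf m) (hg m)
  | smul c f _ hf =>
    obtain ⟨C, hC, hf⟩ := hf
    refine ⟨‖(c : ℂ)‖ * C, by positivity, fun m => ?_⟩
    rw [Pi.smul_apply, Subfield.smul_def, smul_eq_mul, norm_mul, mul_assoc]
    exact mul_le_mul_of_nonneg_left (hf m) (norm_nonneg _)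

lemma one_add_log_pow_le (q : ℕ) :
    ∃ C : ℝ, 0 ≤ C ∧ ∀ m : ℕ, (1 + Real.log ((m : ℝ) + 1)) ^ q ≤ C * ((m : ℝ) + 1) ^ (1 / 2 : ℝ) := by
  have ht : Tendsto (fun m : ℕ => Real.exp 1 * ((m : ℝ) + 1)) atTop atTop :=
    (tendsto_atTop_add_const_right _ _ tendsto_natCast_atTop_atTop).const_mul_atTop
      (Real.exp_pos 1)
  have h := ((isLittleO_log_rpow_rpow_atTop (q : ℝ) (one_half_pos (α := ℝ))).comp_tendsto
    ht).isBigO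
  obtain ⟨C, hC, h⟩ := Asymptotics.bound_of_isBigO_nat_atTop h
  refine ⟨C * (Real.exp 1) ^ (1 / 2 : ℝ), by positivity, fun m => ?_⟩
  have hm : (0 : ℝ) < (m : ℝ) + 1 := by positivity
  have := h (x := m) (by simp only [Function.comp_apply]; positivity)
  simp only [Function.comp_apply, Real.log_mul (Real.exp_pos 1).ne' hm.ne', Real.log_exp,
    Real.rpow_natCast] at this
  rw [Real.norm_of_nonneg (by positivity : (0 : ℝ) ≤ (Real.exp 1 * ((m : ℝ) + 1)) ^ (1 / 2 : ℝ)),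
    Real.mul_rpow (Real.exp_pos 1).le hm.le, ← mul_assoc] at this
  exact (le_abs_self _).trans this

lemma sum_inv_le_one_add_log (N : ℕ) :
    ∑ m ∈ Finset.range N, ((m : ℝ) + 1)⁻¹ ≤ 1 + Real.log ((N : ℝ) + 1) := by
  have h := harmonic_le_one_add_log N
  simp only [harmonic] at h
  push_cast at h
  refine h.trans ?_
  rcases N.eq_zero_or_pos with rfl | hN
  · simp
  · have : (0 : ℝ) < N := by exact_mod_cast hN
    have := Real.log_le_log this (by linarith : (N : ℝ) ≤ N + 1)
    linarith

lemma norm_nestedSum_le_log {e : ℕ} (he : e ≤ 1) (L : List (ℕ → ℂ))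
    (hL : ∀ f ∈ L, ∃ C : ℝ, 0 ≤ C ∧ ∀ m : ℕ, ‖f m‖ ≤ C * ((m : ℝ) + 1)⁻¹) :
    ∃ C : ℝ, 0 ≤ C ∧ ∀ N : ℕ, ‖nestedSum e L N‖ ≤ C * (1 + Real.log ((N : ℝ) + 1)) ^ L.length := by
  induction L with
  | nil => exact ⟨1, zero_le_one, fun N => by simp⟩
  | cons f L ih =>
    obtain ⟨C, hC, hf⟩ := hL f (by simp)
    obtain ⟨C', hC', ih⟩ := ih fun g hg => hL g (by simp [hg])
    refine ⟨C * C', by positivity, fun N => ?_⟩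
    have hlog : ∀ n : ℕ, 0 ≤ Real.log ((n : ℝ) + 1) := fun n =>
      Real.log_nonneg (by linarith [(n.cast_nonneg : (0 : ℝ) ≤ n)])
    have hterm : ∀ m ∈ Finset.range N, ‖f m * nestedSum e L (m + e)‖ ≤
        C * C' * (1 + Real.log ((N : ℝ) + 1)) ^ L.length * ((m : ℝ) + 1)⁻¹ := by
      intro m hm
      have hmN : m + e ≤ N := by have := Finset.mem_range.1 hm; omega
      have h1 : (1 + Real.log (((m + e : ℕ) : ℝ) + 1)) ^ L.length ≤
          (1 + Real.log ((N : ℝ) + 1)) ^ L.length := by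
        have : ((m + e : ℕ) : ℝ) ≤ N := by exact_mod_cast hmN
        have := Real.log_le_log (by positivity)
          (by linarith : ((m + e : ℕ) : ℝ) + 1 ≤ (N : ℝ) + 1)
        refine pow_le_pow_left₀ ?_ (by linarith) _
        linarith [hlog (m + e)]
      rw [norm_mul]
      calc ‖f m‖ * ‖nestedSum e L (m + e)‖
          ≤ (C * ((m : ℝ) + 1)⁻¹) * (C' * (1 + Real.log ((N : ℝ) + 1)) ^ L.length) :=
            mul_le_mul (hf m) ((ih _).trans (mul_le_mul_of_nonneg_left h1 hC'))
              (norm_nonneg _) (by positivity)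
        _ = _ := by ring
    rw [nestedSum_cons]
    refine (norm_sum_le_of_le _ hterm).trans ?_
    rw [← Finset.mul_sum, List.length_cons, pow_succ, ← mul_assoc]
    refine mul_le_mul_of_nonneg_left (sum_inv_le_one_add_log N) ?_
    have := hlog N
    positivity

lemma norm_nestedSum_le_sqrt {e : ℕ} (he : e ≤ 1) (L : List (ℕ → ℂ))
    (hL : ∀ f ∈ L, ∃ C : ℝ, 0 ≤ C ∧ ∀ m : ℕ, ‖f m‖ ≤ C * ((m : ℝ) + 1)⁻¹) :
    ∃ C : ℝ, 0 ≤ C ∧ ∀ N : ℕ, ‖nestedSum e L N‖ ≤ C * ((N : ℝ) + 1) ^ (1 / 2 : ℝ) := by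
  obtain ⟨C, hC, h⟩ := norm_nestedSum_le_log he L hL
  obtain ⟨C', hC', h'⟩ := one_add_log_pow_le L.length
  refine ⟨C * C', by positivity, fun N => (h N).trans ?_⟩
  rw [mul_assoc]
  exact mul_le_mul_of_nonneg_left (h' N) hC

lemma tendsto_mul_nestedSum_zero {F : ℕ → ℂ} {L : List (ℕ → ℂ)} (hF : F ∈ seqFil K (-1))
    (hL : ∀ f ∈ L, f ∈ seqFil K (-1)) :
    Tendsto (fun N => F N * nestedSum 1 L N) atTop (𝓝 0) := by
  obtain ⟨C, hC, hF⟩ := norm_le_of_mem_seqFil hF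
  obtain ⟨C', hC', h⟩ := norm_nestedSum_le_sqrt le_rfl L fun f hf => norm_le_of_mem_seqFil (hL f hf)
  have ht : Tendsto (fun N : ℕ => C * C' * ((N : ℝ) + 1) ^ (-(1 / 2) : ℝ)) atTop (𝓝 0) := by
    simpa using ((tendsto_rpow_neg_atTop (one_half_pos (α := ℝ))).comp
      (tendsto_atTop_add_const_right _ (1 : ℝ) tendsto_natCast_atTop_atTop)).const_mul (C * C')
  refine squeeze_zero_norm (fun N => ?_) ht
  have hN : (0 : ℝ) < (N : ℝ) + 1 := by positivity
  rw [norm_mul]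
  calc ‖F N‖ * ‖nestedSum 1 L N‖
      ≤ (C * ((N : ℝ) + 1)⁻¹) * (C' * ((N : ℝ) + 1) ^ (1 / 2 : ℝ)) :=
        mul_le_mul (hF N) (h N) (norm_nonneg _) (by positivity)
    _ = C * C' * (((N : ℝ) + 1) ^ (-1 : ℝ) * ((N : ℝ) + 1) ^ (1 / 2 : ℝ)) := by
        rw [Real.rpow_neg_one]
        ring
    _ = _ := by
        rw [← Real.rpow_add hN]
        norm_num

lemma norm_nestedSum_cons_le {f : ℕ → ℂ} {L : List (ℕ → ℂ)}
    (hf : ∀ m : ℕ, ‖f m‖ ≤ (((m : ℝ) + 1) ^ 2)⁻¹)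
    (hL : ∀ f ∈ L, ∃ C : ℝ, 0 ≤ C ∧ ∀ m : ℕ, ‖f m‖ ≤ C * ((m : ℝ) + 1)⁻¹) :
    ∃ B : ℝ, ∀ N, ‖nestedSum 0 (f :: L) N‖ ≤ B := by
  obtain ⟨C, hC, h⟩ := norm_nestedSum_le_sqrt zero_le_one L hL
  have hs : Summable fun m : ℕ => C * ((m : ℝ) + 1) ^ (-(3 / 2) : ℝ) := by
    have := (summable_nat_add_iff 1).2
      (Real.summable_nat_rpow (p := (-(3 / 2) : ℝ)).2 (by norm_num))
    simpa using this.mul_left C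
  refine ⟨∑' m : ℕ, C * ((m : ℝ) + 1) ^ (-(3 / 2) : ℝ), fun N => ?_⟩
  rw [nestedSum_cons]
  refine (norm_sum_le_of_le _ fun m _ => ?_).trans
    (hs.sum_le_tsum (Finset.range N) fun m _ => by positivity)
  have hm : (0 : ℝ) < (m : ℝ) + 1 := by positivity
  rw [norm_mul, add_zero]
  calc ‖f m‖ * ‖nestedSum 0 L m‖
      ≤ (((m : ℝ) + 1) ^ 2)⁻¹ * (C * ((m : ℝ) + 1) ^ (1 / 2 : ℝ)) :=
        mul_le_mul (hf m) (h m) (norm_nonneg _) (by positivity)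
    _ = C * (((m : ℝ) + 1) ^ (-2 : ℝ) * ((m : ℝ) + 1) ^ (1 / 2 : ℝ)) := by
        rw [Real.rpow_neg hm.le, Real.rpow_two]
        ring
    _ = _ := by
        rw [← Real.rpow_add hm]
        norm_num

end Growth

/-- The tuples `k` with entries `< N` such that `k j < k i + e` for `i < j`. -/
def tupleSet (e p N : ℕ) : Finset (Fin p → ℕ) :=
  (Fintype.piFinset fun _ => Finset.range N).filter fun k => ∀ i j, i < j → k j < k i + e

lemma mem_tupleSet {e p N : ℕ} {k : Fin p → ℕ} :
    k ∈ tupleSet e p N ↔ (∀ i, k i < N) ∧ ∀ i j, i < j → k j < k i + e := by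
  simp [tupleSet]

lemma sum_tupleSet_prod {e : ℕ} (he : e ≤ 1) {p : ℕ} (f : Fin p → ℕ → ℂ) (N : ℕ) :
    ∑ k ∈ tupleSet e p N, ∏ i, f i (k i) = nestedSum e (List.ofFn f) N := by
  induction p generalizing N with
  | zero =>
    have : tupleSet e 0 N = Finset.univ := by
      exact Finset.eq_univ_iff_forall.2 fun k =>
        mem_tupleSet.2 ⟨fun i => i.elim0, fun i => i.elim0⟩
    simp [this]
  | succ p ih =>
    rw [List.ofFn_succ, nestedSum_cons]
    simp_rw [← ih, Finset.mul_sum]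
    rw [Finset.sum_sigma']
    symm
    refine Finset.sum_bij' (fun x _ => Fin.cons x.1 x.2) (fun k _ => ⟨k 0, Fin.tail k⟩) ?_ ?_ ?_ ?_ ?_
    · rintro ⟨m, k⟩ hx
      simp only [Finset.mem_sigma, Finset.mem_range, mem_tupleSet] at hx ⊢
      obtain ⟨hm, hk, hk'⟩ := hx
      refine ⟨Fin.cases hm fun i => ?_, Fin.cases (Fin.cases (by simp) fun j _ => ?_)
        fun i => Fin.cases (by simp) fun j hij => ?_⟩
      · have := hk i
        simp only [Fin.cons_succ]
        omega
      · simpa using hk j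
      · simpa using hk' i j (by simpa using hij)
    · intro k hk
      simp only [Finset.mem_sigma, Finset.mem_range, mem_tupleSet] at hk ⊢
      exact ⟨hk.1 0, fun i => hk.2 0 i.succ (Fin.succ_pos i),
        fun i j hij => hk.2 i.succ j.succ (by simpa using hij)⟩
    · rintro ⟨m, k⟩ _
      simp
    · intro k _
      simp
    · rintro ⟨m, k⟩ _
      simp [Fin.prod_univ_succ]

section Tuples

variable {e p : ℕ} {R : (Fin p → ℕ) → Prop}

lemma injective_sub_one :
    Function.Injective fun (x : {k : Fin p → ℕ // R k ∧ ∀ i, 1 ≤ k i}) (i : Fin p) => x.1 i - 1 := by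
  intro x y hxy
  ext i
  have := congrFun hxy i
  have := x.2.2 i
  have := y.2.2 i
  simp only at *
  omega

lemma tendsto_sum_tupleSet (hR : ∀ k, R k ↔ ∀ i j, i < j → k j < k i + e)
    (G : (Fin p → ℕ) → ℂ)
    (h : Summable fun k : {k : Fin p → ℕ // R k ∧ ∀ i, 1 ≤ k i} => G k.1) :
    Tendsto (fun N => ∑ k ∈ tupleSet e p N, G fun i => k i + 1) atTop
      (𝓝 (∑' k : {k : Fin p → ℕ // R k ∧ ∀ i, 1 ≤ k i}, G k.1)) := by
  set φ : {k : Fin p → ℕ // R k ∧ ∀ i, 1 ≤ k i} → Fin p → ℕ := fun x i => x.1 i - 1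
  have hφ : Function.Injective φ := injective_sub_one
  have hS : ∀ N, ∑ k ∈ tupleSet e p N, G (fun i => k i + 1) =
      ∑ x ∈ (tupleSet e p N).preimage φ hφ.injOn, G x.1 := by
    intro N
    rw [← Finset.sum_preimage φ (tupleSet e p N) hφ.injOn fun k => G fun i => k i + 1]
    · refine Finset.sum_congr rfl fun x _ => congrArg G (funext fun i => ?_)
      exact Nat.sub_add_cancel (x.2.2 i)
    · intro k hk hk'
      refine absurd ⟨⟨fun i => k i + 1, (hR _).2 fun i j hij => ?_, fun i => by simp⟩, ?_⟩ hk'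
      · have := (mem_tupleSet.1 hk).2 i j hij
        omega
      · funext i
        simp [φ]
  simp_rw [hS]
  refine h.hasSum.comp (tendsto_atTop_finset_of_monotone (fun N N' hN x hx => ?_) fun x => ?_)
  · rw [Finset.mem_preimage, mem_tupleSet] at hx ⊢
    exact ⟨fun i => (hx.1 i).trans_le hN, hx.2⟩
  · refine ⟨∑ i, x.1 i, ?_⟩
    rw [Finset.mem_preimage, mem_tupleSet]
    refine ⟨fun i => ?_, fun i j hij => ?_⟩
    · have := x.2.2 i
      have := Finset.single_le_sum (f := x.1) (fun i _ => Nat.zero_le _) (Finset.mem_univ i)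
      simp only [φ]
      omega
    · have := x.2.2 i
      have := x.2.2 j
      have := (hR _).1 x.2.1 i j hij
      simp only [φ]
      omega

lemma summable_of_sum_tupleSet_le (hR : ∀ k, R k ↔ ∀ i j, i < j → k j < k i + e)
    {G : (Fin p → ℕ) → ℝ} (hG : ∀ k, 0 ≤ G k) {B : ℝ}
    (h : ∀ N, ∑ k ∈ tupleSet e p N, G (fun i => k i + 1) ≤ B) :
    Summable fun k : {k : Fin p → ℕ // R k ∧ ∀ i, 1 ≤ k i} => G k.1 := by
  refine summable_of_sum_le (fun k => hG k.1) (c := B) fun u => ?_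
  refine le_trans ?_ (h (∑ x ∈ u, ∑ i, x.1 i))
  rw [← Finset.sum_image (s := u) (f := fun k => G fun i => k i + 1)
    (g := fun x i => x.1 i - 1) injective_sub_one.injOn |>.trans
      (Finset.sum_congr rfl fun x _ => congrArg G (funext fun i => Nat.sub_add_cancel (x.2.2 i)))]
  refine Finset.sum_le_sum_of_subset_of_nonneg (fun k hk => ?_) fun _ _ _ => hG _
  obtain ⟨x, hx, rfl⟩ := Finset.mem_image.1 hk
  refine mem_tupleSet.2 ⟨fun i => ?_, fun i j hij => ?_⟩
  · have := x.2.2 i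
    have := Finset.single_le_sum (f := x.1) (fun i _ => Nat.zero_le _) (Finset.mem_univ i)
    have := Finset.single_le_sum (f := fun x => ∑ i, x.1 i) (fun i _ => Nat.zero_le _) hx
    omega
  · have := x.2.2 i
    have := x.2.2 j
    have := (hR _).1 x.2.1 i j hij
    omega

end Tuples

lemma norm_powSeq_le {s b : ℕ} (h : b ≤ s) (m : ℕ) :
    ‖powSeq s 0 m‖ ≤ (((m : ℝ) + 1) ^ b)⁻¹ := by
  have hm : ‖(m : ℂ) + 1‖ = (m : ℝ) + 1 := by
    rw [← Nat.cast_add_one, Complex.norm_natCast]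
    push_cast
    rfl
  simp only [powSeq, Nat.cast_zero, add_zero, norm_inv, norm_pow, hm]
  have h1 : (1 : ℝ) ≤ (m : ℝ) + 1 := by linarith [(m.cast_nonneg : (0 : ℝ) ≤ m)]
  exact inv_anti₀ (by positivity) (pow_le_pow_right₀ h1 h)

lemma tendsto_nestedSum_mzv {s : List ℕ} (hs : ∀ a ∈ s, 1 ≤ a) (hs' : s ≠ [] → 2 ≤ s.headI) :
    Tendsto (nestedSum 0 (s.map fun a => powSeq a 0)) atTop (𝓝 ((mzv s : ℝ) : ℂ)) := by
  have hR : ∀ k : Fin s.length → ℕ, StrictAnti k ↔ ∀ i j, i < j → k j < k i + 0 := fun k => Iff.rfl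
  have hsum : ∀ N, ((∑ k ∈ tupleSet 0 s.length N,
      ∏ i, (((k i + 1 : ℕ) : ℝ) ^ s.get i)⁻¹ : ℝ) : ℂ) =
      nestedSum 0 (s.map fun a => powSeq a 0) N := by
    intro N
    rw [show s.map (fun a => powSeq a 0) = List.ofFn fun i => powSeq (s.get i) 0 by
      conv_lhs => rw [← List.ofFn_get s, List.map_ofFn]
      rfl, ← sum_tupleSet_prod zero_le_one]
    push_cast
    simp [powSeq]
  have hB : ∃ B : ℝ, ∀ N, ‖nestedSum 0 (s.map fun a => powSeq a 0) N‖ ≤ B := by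
    cases s with
    | nil => exact ⟨1, fun N => by simp⟩
    | cons a s =>
      refine norm_nestedSum_cons_le (norm_powSeq_le (by simpa using hs')) fun f hf => ?_
      obtain ⟨b, hb, rfl⟩ := List.mem_map.1 hf
      exact ⟨1, zero_le_one, fun m => by
        simpa using norm_powSeq_le (hs b (List.mem_cons_of_mem _ hb)) m⟩
  obtain ⟨B, hB⟩ := hB
  have hS : Summable fun k : {k : Fin s.length → ℕ // StrictAnti k ∧ ∀ i, 1 ≤ k i} =>
      ∏ i, ((k.1 i : ℝ) ^ s.get i)⁻¹ := by
    refine summable_of_sum_tupleSet_le hR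
      (G := fun k => ∏ i, ((k i : ℝ) ^ s.get i)⁻¹) (fun k => by positivity) (B := B) fun N => ?_
    have := hB N
    rw [← hsum, Complex.norm_real] at this
    exact (le_abs_self _).trans this
  have h := tendsto_sum_tupleSet hR (fun k => ((∏ i, ((k i : ℝ) ^ s.get i)⁻¹ : ℝ) : ℂ))
    (by exact_mod_cast hS)
  rw [mzv, Complex.ofReal_tsum]
  refine h.congr fun N => ?_
  rw [← hsum, Complex.ofReal_sum]

/-- Summation against the sequence `1 / (m + 1) ^ s`, with the upper bound shifted by one. -/
noncomputable def sumPowSeq (K : Subfield ℂ) (s : ℕ) : (ℕ → ℂ) →ₗ[K] (ℕ → ℂ) where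
  toFun g N := ∑ m ∈ Finset.range N, powSeq s 0 m * g (m + 1)
  map_add' f g := by
    funext N
    simp [mul_add, Finset.sum_add_distrib]
  map_smul' c g := by
    funext N
    simp only [Pi.smul_apply, Subfield.smul_def, smul_eq_mul, Finset.mul_sum, RingHom.id_apply]
    exact Finset.sum_congr rfl fun m _ => by ring

lemma sumPowSeq_nestedSum_zero (K : Subfield ℂ) (s a : ℕ) (t : List ℕ) :
    sumPowSeq K s (nestedSum 0 ((a :: t).map fun a => powSeq a 0)) =
      nestedSum 0 ((s :: a :: t).map fun a => powSeq a 0) +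
        nestedSum 0 (((s + a) :: t).map fun a => powSeq a 0) := by
  funext N
  simp only [sumPowSeq, LinearMap.coe_mk, AddHom.coe_mk, Pi.add_apply, List.map_cons]
  rw [nestedSum_cons, nestedSum_cons, ← Finset.sum_add_distrib]
  refine Finset.sum_congr rfl fun m _ => ?_
  rw [nestedSum_cons, nestedSum_cons, Finset.sum_range_succ]
  simp only [powSeq, pow_add, mul_inv, add_zero]
  ring

lemma nestedSum_one_sub_zero_mem_span (K : Subfield ℂ) {t : List ℕ} (ht : ∀ a ∈ t, 1 ≤ a) :
    nestedSum 1 (t.map fun a => powSeq a 0) - nestedSum 0 (t.map fun a => powSeq a 0) ∈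
      Submodule.span K ((fun u : List ℕ => nestedSum 0 (u.map fun a => powSeq a 0)) ''
        {u | (∀ a ∈ u, 1 ≤ a) ∧ u ≠ [] ∧ u.length < t.length ∧ t.headI ≤ u.headI}) := by
  induction t with
  | nil =>
    rw [show nestedSum 1 _ - nestedSum 0 _ = 0 from funext fun N => by simp]
    exact Submodule.zero_mem _
  | cons s t ih =>
    have hs : 1 ≤ s := ht s (by simp)
    have ht' : ∀ a ∈ t, 1 ≤ a := fun a ha => ht a (by simp [ha])
    specialize ih ht'
    have hU : nestedSum 1 ((s :: t).map fun a => powSeq a 0) =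
        sumPowSeq K s (nestedSum 1 (t.map fun a => powSeq a 0)) := rfl
    have h1 : sumPowSeq K s (nestedSum 1 (t.map fun a => powSeq a 0) -
        nestedSum 0 (t.map fun a => powSeq a 0)) ∈
          Submodule.span K ((fun u : List ℕ => nestedSum 0 (u.map fun a => powSeq a 0)) ''
            {u | (∀ a ∈ u, 1 ≤ a) ∧ u ≠ [] ∧ u.length < (s :: t).length ∧
              (s :: t).headI ≤ u.headI}) := by
      rw [← Submodule.mem_comap]
      refine Submodule.span_le.2 ?_ ih
      rintro _ ⟨u, ⟨hu, hu', hut, -⟩, rfl⟩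
      obtain ⟨a, v, rfl⟩ := List.exists_cons_of_ne_nil hu'
      simp only [List.length_cons, List.mem_cons, forall_eq_or_imp] at hut hu
      rw [SetLike.mem_coe, Submodule.mem_comap, sumPowSeq_nestedSum_zero]
      refine Submodule.add_mem _ (Submodule.subset_span ⟨_, ?_, rfl⟩)
        (Submodule.subset_span ⟨_, ?_, rfl⟩)
      · exact ⟨by simpa using ⟨hs, hu⟩, by simp, by simp; omega, by simp⟩
      · refine ⟨?_, by simp, by simp; omega, by simp⟩
        simp only [List.mem_cons, forall_eq_or_imp]
        exact ⟨by omega, hu.2⟩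
    rw [map_sub, ← hU] at h1
    cases t with
    | nil =>
      convert h1 using 2
      funext N
      simp [sumPowSeq, nestedSum_cons]
    | cons a v =>
      simp only [List.mem_cons, forall_eq_or_imp] at ht'
      rw [sumPowSeq_nestedSum_zero] at h1
      have h2 := Submodule.add_mem _ h1 (Submodule.subset_span
        (s := (fun u : List ℕ => nestedSum 0 (u.map fun a => powSeq a 0)) ''
            {u | (∀ a ∈ u, 1 ≤ a) ∧ u ≠ [] ∧ u.length < (s :: a :: v).length ∧
              (s :: a :: v).headI ≤ u.headI}) ⟨(s + a) :: v, ?_, rfl⟩)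
      · convert h2 using 1
        dsimp only
        abel
      · refine ⟨?_, by simp, by simp, by simp⟩
        simp only [List.mem_cons, forall_eq_or_imp]
        exact ⟨by omega, ht'.2⟩

/-- The `K`-span of the multiple zeta values of depth at most `q.length`, where those of depth
`q.length` have exponents `s` with `1 + ℓ ≤ s ≤ A + ℓ` for the corresponding `(ℓ, A)` in `q`. -/
noncomputable def mzvSpan (K : Subfield ℂ) (q : List (ℕ × ℕ)) : Submodule K ℂ :=
  Submodule.span K ((fun s : List ℕ => ((mzv s : ℝ) : ℂ)) ''
    {s | (∀ a ∈ s, 1 ≤ a) ∧ (s ≠ [] → 2 ≤ s.headI) ∧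
      (s.length < q.length ∨ List.Forall₂ (fun a b => 1 + b.1 ≤ a ∧ a ≤ b.2 + b.1) s q)})

/-- The `K`-span of the multiple zeta values of depth at most `n`. -/
noncomputable def mzvSpanLE (K : Subfield ℂ) (n : ℕ) : Submodule K ℂ :=
  Submodule.span K ((fun s : List ℕ => ((mzv s : ℝ) : ℂ)) ''
    {s | (∀ a ∈ s, 1 ≤ a) ∧ (s ≠ [] → 2 ≤ s.headI) ∧ s.length ≤ n})

section MzvSpan

variable {K : Subfield ℂ}

lemma mzvSpanLE_le_mzvSpan {n : ℕ} {q : List (ℕ × ℕ)} (h : n < q.length) :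
    mzvSpanLE K n ≤ mzvSpan K q :=
  Submodule.span_mono (Set.image_mono fun _ hs => ⟨hs.1, hs.2.1, .inl (hs.2.2.trans_lt h)⟩)

lemma mzvSpan_le_mzvSpanLE (q : List (ℕ × ℕ)) : mzvSpan K q ≤ mzvSpanLE K q.length :=
  Submodule.span_mono (Set.image_mono fun _ hs =>
    ⟨hs.1, hs.2.1, hs.2.2.elim le_of_lt fun h => h.length_eq.le⟩)

lemma mzv_nil : mzv [] = 1 := by
  have h := tendsto_nestedSum_mzv (s := []) (by simp) (by simp)
  have := tendsto_nhds_unique h (tendsto_const_nhds.congr fun N => rfl : Tendsto _ _ (𝓝 (1 : ℂ)))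
  exact_mod_cast this

lemma coe_mem_mzvSpanLE (c : K) (n : ℕ) : (c : ℂ) ∈ mzvSpanLE K n := by
  have h : ((mzv [] : ℝ) : ℂ) ∈ mzvSpanLE K n :=
    Submodule.subset_span ⟨[], ⟨by simp, by simp, by simp⟩, rfl⟩
  simpa [mzv_nil, Subfield.smul_def] using Submodule.smul_mem _ c h

lemma limIn_powSeq {q : List (ℕ × ℕ)} {s : List ℕ}
    (hs : List.Forall₂ (fun a b => 1 + b.1 ≤ a ∧ a ≤ b.2 + b.1) s q)
    (hs' : s ≠ [] → 2 ≤ s.headI) : LimIn (mzvSpan K q) (s.map fun a => powSeq a 0) := by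
  have hpos : ∀ a ∈ s, 1 ≤ a := by
    clear hs'
    induction hs with
    | nil => simp
    | cons h _ ih =>
      simp only [List.mem_cons, forall_eq_or_imp]
      exact ⟨by omega, ih⟩
  have hlim : ∀ f ∈ Submodule.span K ((fun u : List ℕ => nestedSum 0 (u.map fun a => powSeq a 0)) ''
        {u | (∀ a ∈ u, 1 ≤ a) ∧ u ≠ [] ∧ u.length < s.length ∧ s.headI ≤ u.headI}),
      ∃ x ∈ mzvSpan K q, Tendsto f atTop (𝓝 x) := by
    intro f hf
    induction hf using Submodule.span_induction with
    | mem f hf =>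
      obtain ⟨u, ⟨hu, -, hlen, hhead⟩, rfl⟩ := hf
      have hne : s ≠ [] := by
        rintro rfl
        simp at hlen
      have h2 : 2 ≤ u.headI := (hs' hne).trans hhead
      exact ⟨_, Submodule.subset_span ⟨u, ⟨hu, fun _ => h2, .inl (hs.length_eq ▸ hlen)⟩, rfl⟩,
        tendsto_nestedSum_mzv hu fun _ => h2⟩
    | zero => exact ⟨0, Submodule.zero_mem _, tendsto_const_nhds⟩
    | add f g _ _ hf hg =>
      obtain ⟨x, hx, hf⟩ := hf
      obtain ⟨y, hy, hg⟩ := hg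
      exact ⟨x + y, Submodule.add_mem _ hx hy, hf.add hg⟩
    | smul c f _ hf =>
      obtain ⟨x, hx, hf⟩ := hf
      exact ⟨c • x, Submodule.smul_mem _ c hx, hf.const_mul (c : ℂ)⟩
  obtain ⟨x, hx, h⟩ := hlim _ (nestedSum_one_sub_zero_mem_span K hpos)
  refine ⟨x + (mzv s : ℝ), Submodule.add_mem _ hx
    (Submodule.subset_span ⟨s, ⟨hpos, hs', .inr hs⟩, rfl⟩), ?_⟩
  simpa using h.add (tendsto_nestedSum_mzv hpos hs')

end MzvSpan

/-- All partial sums `e + (d₁ + 1) + ⋯ + (d_j + 1)` are negative. -/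
def DegGood : ℤ → List ℤ → Prop
  | _, [] => True
  | e, d :: ds => e + d + 1 ≤ -1 ∧ DegGood (e + d + 1) ds

lemma DegGood.merge {e d₁ d₂ d : ℤ} (hd : d = d₁ + d₂ + 1) {pre post : List ℤ}
    (h : DegGood e (pre ++ d₁ :: d₂ :: post)) : DegGood e (pre ++ d :: post) := by
  induction pre generalizing e with
  | nil =>
    simp only [List.nil_append, DegGood] at h ⊢
    rw [show e + d + 1 = e + d₁ + 1 + d₂ + 1 by rw [hd]; ring]
    exact h.2
  | cons a pre ih => exact ⟨h.1, ih h.2⟩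

lemma DegGood.left {e : ℤ} {pre post : List ℤ} (h : DegGood e (pre ++ post)) : DegGood e pre := by
  induction pre generalizing e with
  | nil => trivial
  | cons a pre ih => exact ⟨h.1, ih h.2⟩

lemma degGood_of_forall_le {e : ℤ} (he : e ≤ -1) {ds : List ℤ} (h : ∀ d ∈ ds, d ≤ -1) :
    DegGood e ds := by
  induction ds generalizing e with
  | nil => trivial
  | cons d ds ih =>
    have := h d (by simp)
    exact ⟨by omega, ih (by omega) fun x hx => h x (by simp [hx])⟩

lemma degGood_neg_two_cons {ds : List ℤ} (h : ∀ d ∈ ds, d ≤ -1) : DegGood 0 (-2 :: ds) :=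
  show (0 : ℤ) + -2 + 1 ≤ -1 ∧ DegGood (0 + -2 + 1) ds from
    ⟨by norm_num, degGood_of_forall_le (by norm_num) h⟩

lemma forall₂_or_split {α β : Type*} {P Q : α → β → Prop} {L : List α} {q : List β}
    (h : List.Forall₂ (fun f a => P f a ∨ Q f a) L q) :
    List.Forall₂ P L q ∨ ∃ L₁ f L₂ q₁ a q₂, L = L₁ ++ f :: L₂ ∧ q = q₁ ++ a :: q₂ ∧
      List.Forall₂ (fun f a => P f a ∨ Q f a) L₁ q₁ ∧ Q f a ∧
      List.Forall₂ (fun f a => P f a ∨ Q f a) L₂ q₂ := by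
  induction h with
  | nil => exact .inl .nil
  | @cons f a L q hf hL ih =>
    rcases hf with hf | hf
    · rcases ih with ih | ⟨L₁, g, L₂, q₁, b, q₂, rfl, rfl, h₁, hg, h₂⟩
      · exact .inl (.cons hf ih)
      · exact .inr ⟨f :: L₁, g, L₂, a :: q₁, b, q₂, rfl, rfl, .cons (.inl hf) h₁, hg, h₂⟩
    · exact .inr ⟨[], f, L, [], a, q, rfl, rfl, .nil, hf, hL⟩

lemma forall₂_cons_eq_concat {α β : Type*} {R : α → β → Prop} {L : List α} {q : List β}
    (h : List.Forall₂ R L q) {f : α} {a : β} (hf : R f a) :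
    ∃ L₁ g q₁ b, f :: L = L₁ ++ [g] ∧ a :: q = q₁ ++ [b] ∧ List.Forall₂ R L₁ q₁ ∧ R g b := by
  induction h generalizing f a with
  | nil => exact ⟨[], f, [], a, rfl, rfl, .nil, hf⟩
  | cons hg _ ih =>
    obtain ⟨L₁, g, q₁, b, h₁, h₂, h₃, h₄⟩ := ih hg
    exact ⟨f :: L₁, g, a :: q₁, b, by simp [h₁], by simp [h₂], .cons hf h₃, h₄⟩

lemma forall₂_append {α β : Type*} {R : α → β → Prop} {L₁ L₂ : List α} {q₁ q₂ : List β}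
    (h₁ : List.Forall₂ R L₁ q₁) (h₂ : List.Forall₂ R L₂ q₂) :
    List.Forall₂ R (L₁ ++ L₂) (q₁ ++ q₂) := by
  induction h₁ with
  | nil => exact h₂
  | cons h _ ih => exact .cons h ih

lemma forall₂_replicate {α β : Type*} {R : α → β → Prop} {L : List α} {b : β}
    (h : ∀ f ∈ L, R f b) : List.Forall₂ R L (List.replicate L.length b) := by
  induction L with
  | nil => exact .nil
  | cons f L ih => exact .cons (h f (by simp)) (ih fun g hg => h g (by simp [hg]))

/-- Convergence to a combination of multiple zeta values of depth at most `n`, for all nested sums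
of `n` sequences satisfying the degree condition. -/
def ConvergesToMzvs (K : Subfield ℂ) (n : ℕ) : Prop :=
  ∀ (L : List (ℕ → ℂ)) (ds : List ℤ), L.length = n →
    List.Forall₂ (fun f d => f ∈ seqFil K d) L ds → DegGood 0 ds → LimIn (mzvSpanLE K n) L

section Reduction

variable {K : Subfield ℂ} {n : ℕ}

lemma apply_mem_of_mem_seqFil {d : ℤ} {f : ℕ → ℂ} (hf : f ∈ seqFil K d) (m : ℕ) : f m ∈ K := by
  obtain ⟨h, hh, rfl⟩ := mem_seqFil.1 hf
  clear hf
  dsimp only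
  induction hh using Submodule.span_induction with
  | mem g hg =>
    rcases hg with ⟨a, M, -, rfl⟩ | hg
    · refine mul_mem (pow_mem (add_mem (natCast_mem K m) (one_mem K)) a)
        (inv_mem (multiset_prod_mem _ fun x hx => ?_))
      obtain ⟨j, -, rfl⟩ := Multiset.mem_map.1 hx
      exact add_mem (add_mem (natCast_mem K m) (one_mem K)) (natCast_mem K j)
    · rw [hg _ (natCast_add_one_re_pos m)]
      exact zero_mem K
  | zero => exact zero_mem K
  | add f g _ _ hf hg => exact add_mem hf hg
  | smul c f _ hf => exact mul_mem c.2 hf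

lemma ConvergesToMzvs.limIn_teleSub (hn : ConvergesToMzvs K n) {pre post : List (ℕ → ℂ)}
    {f₀ f : ℕ → ℂ} {dpre dpost : List ℤ} {d₀ d : ℤ} (hf₀ : f₀ ∈ seqFil K d₀)
    (hpre : List.Forall₂ (fun f d => f ∈ seqFil K d) pre dpre) (hf : f ∈ teleSub K d)
    (hpost : List.Forall₂ (fun f d => f ∈ seqFil K d) post dpost)
    (hgood : DegGood 0 ((d₀ :: dpre) ++ d :: dpost))
    (hlen : pre.length + 1 + post.length = n) :
    LimIn (mzvSpanLE K n) (f₀ :: pre ++ f :: post) := by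
  obtain ⟨F, hF, rfl⟩ := mem_teleSub.1 hf
  obtain ⟨L₁, h, q₁, dh, hL, hq, hL₁, hh⟩ := forall₂_cons_eq_concat hpre hf₀
  have hlen' := congrArg List.length hL
  simp only [List.length_cons, List.length_append, List.length_nil] at hlen'
  rw [hL, List.append_assoc, List.singleton_append]
  rw [hq, List.append_assoc, List.singleton_append] at hgood
  have hhF : (fun m => h m * F (m + 1)) ∈ seqFil K (dh + (d + 1)) :=
    seqFil_mul hh (seqFil_shift hF)
  rcases hpost with _ | ⟨hg, hpost⟩
  · refine LimIn.lincomb (-⟨F 0, apply_mem_of_mem_seqFil hF 0⟩)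
      (nestedSum_append_lincomb 1 _ (nestedSum_cons_telescope_nil h F) L₁) ?_ ?_
    · refine hn _ (q₁ ++ [dh + (d + 1)]) ?_ (forall₂_append hL₁ (.cons hhF .nil))
        (hgood.merge (by ring))
      simp only [List.length_append, List.length_cons, List.length_nil] at hlen ⊢
      omega
    · refine hn _ (q₁ ++ [dh]) ?_ (forall₂_append hL₁ (.cons hh .nil)) ?_
      · simp only [List.length_append, List.length_cons, List.length_nil] at hlen ⊢
        omega
      · refine DegGood.left (post := [d]) ?_
        simpa using hgood
  · rename_i g dg post dpost
    refine LimIn.lincomb (-1) (Y := L₁ ++ (fun m => h m * F (m + 1)) :: g :: post)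
      (Z := L₁ ++ h :: (F * g) :: post) ?_ ?_ ?_
    · push_cast
      exact nestedSum_append_lincomb 1 _ (nestedSum_cons_telescope h F g post) L₁
    · refine hn _ (q₁ ++ (dh + (d + 1)) :: dg :: dpost) ?_
        (forall₂_append hL₁ (.cons hhF (.cons hg hpost))) (hgood.merge (by ring))
      simp only [List.length_append, List.length_cons] at hlen ⊢
      omega
    · refine hn _ (q₁ ++ dh :: (d + 1 + dg) :: dpost) ?_
        (forall₂_append hL₁ (.cons hh (.cons (seqFil_mul hF hg) hpost))) ?_
      · simp only [List.length_append, List.length_cons] at hlen ⊢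
        omega
      · have := DegGood.merge (e := 0) (d₁ := d) (d₂ := dg) (d := d + 1 + dg) (by ring)
          (pre := q₁ ++ [dh]) (post := dpost) (by simpa using hgood)
        simpa using this

lemma ConvergesToMzvs.limIn_head_teleSub (hn : ConvergesToMzvs K n) {f : ℕ → ℂ}
    {L : List (ℕ → ℂ)} (hf : f ∈ teleSub K (-2)) (hL : ∀ g ∈ L, g ∈ seqFil K (-1))
    (hlen : L.length = n) : LimIn (mzvSpanLE K n) (f :: L) := by
  obtain ⟨F, hF, rfl⟩ := mem_teleSub.1 hf
  norm_num at hF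
  have h0 := tendsto_mul_nestedSum_zero hF hL
  cases L with
  | nil =>
    refine ⟨0 - F 0, ?_, ?_⟩
    · rw [zero_sub]
      exact Submodule.neg_mem _ (coe_mem_mzvSpanLE ⟨F 0, apply_mem_of_mem_seqFil hF 0⟩ n)
    · simp only [nestedSum_nil, mul_one] at h0
      exact (h0.sub_const (F 0)).congr fun N => (nestedSum_telescope_nil F N).symm
  | cons g L =>
    have hFg : F * g ∈ seqFil K (-2) :=
      seqFil_mono (by norm_num) (seqFil_mul hF (hL g (by simp)))
    obtain ⟨x, hx, hlim⟩ := hn ((F * g) :: L) (-2 :: List.replicate L.length (-1)) hlen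
      (.cons hFg (forall₂_replicate fun h hh => hL h (by simp [hh])))
      (degGood_neg_two_cons fun d hd => (List.eq_of_mem_replicate hd).le)
    exact ⟨0 - x, by simpa using hx,
      (h0.sub hlim).congr fun N => (nestedSum_telescope F g L N).symm⟩

/-- The sequences `1 / (m + 1) ^ (s + ℓ)` with `1 ≤ s ≤ A` and `b ≤ s + ℓ`. -/
def powSeqs (ℓ A b : ℕ) : Set (ℕ → ℂ) :=
  {f | ∃ s, 1 ≤ s ∧ s ≤ A ∧ b ≤ s + ℓ ∧ f = powSeq (s + ℓ) 0}

lemma derivSeq_replicate_mem_span {ℓ A b s j : ℕ} (hs : 1 ≤ s) (hA : s ≤ A) (hb : b ≤ s + ℓ) :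
    derivSeq ℓ (ratGen 0 (Multiset.replicate s j)) ∈
      Submodule.span K (powSeqs ℓ A b ∪ teleSub K (-2)) := by
  obtain ⟨c, hc⟩ := derivSeq_replicate K ℓ s
  rw [hc, ← sub_add_cancel (powSeq (s + ℓ) j) (powSeq (s + ℓ) 0)]
  refine Submodule.smul_mem _ _ (Submodule.add_mem _ (Submodule.subset_span (.inr ?_))
    (Submodule.subset_span (.inl ⟨s, hs, hA, hb, rfl⟩)))
  exact teleSub_mono (by push_cast; omega) (powSeq_sub_mem_teleSub (s + ℓ) j)

lemma derivSeq_mem_span_of_two_le_card {ℓ A : ℕ} {M : Multiset ℕ} (hM : 2 ≤ M.card)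
    (hA : ∀ j, M.count j ≤ A) :
    derivSeq ℓ (ratGen 0 M) ∈ Submodule.span K (powSeqs ℓ A 2 ∪ teleSub K (-2)) := by
  refine Submodule.span_le.2 ?_ (derivSeq_mem_span (K := K) ℓ ?_ (ratGen_mem_span_replicate M hM hA))
  · rintro _ ⟨_, ⟨s, j, hs, hsA, rfl⟩ | ⟨i, j, rfl⟩, rfl⟩
    · exact derivSeq_replicate_mem_span (by omega) hsA (by omega)
    · obtain ⟨c, hc⟩ := derivSeq_replicate K ℓ 1
      have : derivSeq ℓ (ratGen 0 (Multiset.replicate 1 i) - ratGen 0 (Multiset.replicate 1 j)) =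
          c • ((powSeq (1 + ℓ) i - powSeq (1 + ℓ) 0) - (powSeq (1 + ℓ) j - powSeq (1 + ℓ) 0)) := by
        rw [sub_sub_sub_cancel_right, smul_sub, ← hc, ← hc]
        exact funext fun m => iteratedDeriv_sub
          (analyticAt_ratGen 0 _ (natCast_add_one_re_pos m)).contDiffAt
          (analyticAt_ratGen 0 _ (natCast_add_one_re_pos m)).contDiffAt
      rw [this]
      have h := fun j => teleSub_mono (K := K) (e := -2) (by push_cast; omega)
        (powSeq_sub_mem_teleSub (1 + ℓ) j)
      exact Submodule.subset_span (.inr (Submodule.smul_mem _ _ (Submodule.sub_mem _ (h i) (h j))))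
  · rintro _ (⟨s, j, -, -, rfl⟩ | ⟨i, j, rfl⟩) z hz
    · exact analyticAt_ratGen _ _ hz
    · exact (analyticAt_ratGen _ _ hz).sub (analyticAt_ratGen _ _ hz)

lemma derivSeq_mem_span_of_ne_zero {ℓ A : ℕ} {M : Multiset ℕ} (hM : M ≠ 0)
    (hA : ∀ j, M.count j ≤ A) :
    derivSeq ℓ (ratGen 0 M) ∈ Submodule.span K (powSeqs ℓ A 1 ∪ teleSub K (-2)) := by
  rcases Nat.lt_or_ge M.card 2 with h | h
  · obtain ⟨j, rfl⟩ := Multiset.card_eq_one.1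
      (show M.card = 1 by have := Multiset.card_pos.2 hM; omega)
    have hj := hA j
    rw [Multiset.count_singleton_self] at hj
    rw [← Multiset.replicate_one]
    exact derivSeq_replicate_mem_span le_rfl hj (by omega)
  · refine Submodule.span_mono (Set.union_subset_union_left _ ?_)
      (derivSeq_mem_span_of_two_le_card h hA)
    rintro _ ⟨s, hs, hsA, hb, rfl⟩
    exact ⟨s, hs, hsA, by omega, rfl⟩

end Reduction

section Convergence

variable {K : Subfield ℂ} {n : ℕ}

lemma powSeq_mem_seqFil_of_mem_powSeqs {ℓ A b : ℕ} {d : ℤ} {f : ℕ → ℂ} (hf : f ∈ powSeqs ℓ A b)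
    (hd : -(b : ℤ) ≤ d) : f ∈ seqFil K d := by
  obtain ⟨s, -, -, hb, rfl⟩ := hf
  exact powSeq_mem_seqFil 0 (by push_cast; omega)

lemma forall_mem_seqFil_of_forall₂ {L : List (ℕ → ℂ)} {q : List (ℕ × ℕ)}
    (h : List.Forall₂ (fun f b => f ∈ powSeqs b.1 b.2 1 ∨ f ∈ teleSub K (-2)) L q) :
    ∀ f ∈ L, f ∈ seqFil K (-1) := by
  induction h with
  | nil => simp
  | cons h _ ih =>
    simp only [List.mem_cons, forall_eq_or_imp]
    exact ⟨h.elim (fun h => powSeq_mem_seqFil_of_mem_powSeqs h (by norm_num))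
      fun h => seqFil_mono (by norm_num) (teleSub_le_seqFil h), ih⟩

lemma exists_eq_map_powSeq {L : List (ℕ → ℂ)} {q : List (ℕ × ℕ)}
    (h : List.Forall₂ (fun f b => f ∈ powSeqs b.1 b.2 1) L q) :
    ∃ s : List ℕ, List.Forall₂ (fun a b => 1 + b.1 ≤ a ∧ a ≤ b.2 + b.1) s q ∧
      L = s.map fun a => powSeq a 0 := by
  induction h with
  | nil => exact ⟨[], .nil, rfl⟩
  | @cons f b L q h _ ih =>
    obtain ⟨a, h1, hA, -, rfl⟩ := h
    obtain ⟨s, hs, rfl⟩ := ih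
    exact ⟨(a + b.1) :: s, .cons ⟨by omega, by omega⟩ hs, rfl⟩

lemma ConvergesToMzvs.limIn_of_powSeqs_union_teleSub (hn : ConvergesToMzvs K n)
    {f₀ : ℕ → ℂ} {b₀ : ℕ × ℕ} {L : List (ℕ → ℂ)} {q : List (ℕ × ℕ)} (hq : q.length = n)
    (hf₀ : f₀ ∈ powSeqs b₀.1 b₀.2 2 ∨ f₀ ∈ teleSub K (-2))
    (hL : List.Forall₂ (fun f b => f ∈ powSeqs b.1 b.2 1 ∨ f ∈ teleSub K (-2)) L q) :
    LimIn (mzvSpan K (b₀ :: q)) (f₀ :: L) := by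
  have hle : mzvSpanLE K n ≤ mzvSpan K (b₀ :: q) := mzvSpanLE_le_mzvSpan (by simp [hq])
  have hLn : L.length = n := hL.length_eq.trans hq
  rcases hf₀ with hf₀ | hf₀
  · have hf₀' : f₀ ∈ seqFil K (-2) := powSeq_mem_seqFil_of_mem_powSeqs hf₀ (by norm_num)
    rcases forall₂_or_split hL with hL | ⟨L₁, f, L₂, q₁, b, q₂, rfl, -, h₁, hf, h₂⟩
    · obtain ⟨s, hs, rfl⟩ := exists_eq_map_powSeq hL
      obtain ⟨a, h1, hA, h2, rfl⟩ := hf₀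
      refine limIn_powSeq (s := (a + b₀.1) :: s) (.cons ⟨by omega, by omega⟩ hs) fun _ => h2
    · have hf' : f ∈ teleSub K (-1) := teleSub_mono (by norm_num) hf
      have hgood : DegGood 0 ((-2 :: List.replicate L₁.length (-1)) ++
          (-1) :: List.replicate L₂.length (-1)) := by
        refine degGood_neg_two_cons fun d hd => ?_
        simp only [List.append_eq, List.mem_append, List.mem_cons, List.mem_replicate] at hd
        omega
      refine LimIn.mono hle (hn.limIn_teleSub hf₀'
        (forall₂_replicate (forall_mem_seqFil_of_forall₂ h₁)) hf'
        (forall₂_replicate (forall_mem_seqFil_of_forall₂ h₂)) hgood ?_)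
      simp only [List.length_append, List.length_cons] at hLn
      omega
  · exact LimIn.mono hle (hn.limIn_head_teleSub hf₀ (forall_mem_seqFil_of_forall₂ hL) hLn)

/-- `f` is the sequence of values of the `ℓ`-th derivative of a generator of degree at most `d`
with poles of order at most `A`, where `b = (ℓ, A, d)`. -/
def IsEntry (f : ℕ → ℂ) (b : ℕ × ℕ × ℤ) : Prop :=
  ∃ (a : ℕ) (M : Multiset ℕ), (a : ℤ) - M.card ≤ b.2.2 ∧ (∀ j, M.count j ≤ b.2.1) ∧
    f = derivSeq b.1 (ratGen a M)

/-- The entries with constant numerator and at least one pole. -/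
def IsFracEntry (f : ℕ → ℂ) (b : ℕ × ℕ × ℤ) : Prop :=
  ∃ M : Multiset ℕ, M ≠ 0 ∧ -(M.card : ℤ) ≤ b.2.2 ∧ (∀ j, M.count j ≤ b.2.1) ∧
    f = derivSeq b.1 (ratGen 0 M)

/-- The entries without poles. -/
def IsPowEntry (f : ℕ → ℂ) (b : ℕ × ℕ × ℤ) : Prop :=
  ∃ a : ℕ, (a : ℤ) ≤ b.2.2 ∧ f = derivSeq b.1 (ratGen a 0)

lemma IsEntry.mem_span {f : ℕ → ℂ} {b : ℕ × ℕ × ℤ} (h : IsEntry f b) :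
    f ∈ Submodule.span K {f | IsFracEntry f b ∨ IsPowEntry f b} := by
  obtain ⟨a, M, ha, hM, rfl⟩ := h
  refine Submodule.span_le.2 ?_
    (derivSeq_mem_span (K := K) b.1 ?_ (ratGen_mem_span_pow_union_frac a M))
  · rintro _ ⟨_, ⟨x, hx, rfl⟩ | ⟨M', hM', h0, hx, rfl⟩, rfl⟩
    · exact Submodule.subset_span (.inr ⟨x, hx.trans ha, rfl⟩)
    · exact Submodule.subset_span (.inl ⟨M', h0, hx.trans ha,
        fun j => (Multiset.count_le_of_le j hM').trans (hM j), rfl⟩)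
  · rintro _ (⟨x, -, rfl⟩ | ⟨M', -, -, -, rfl⟩) z hz <;> exact analyticAt_ratGen _ _ hz

lemma IsPowEntry.mem_teleSub {f : ℕ → ℂ} {b : ℕ × ℕ × ℤ} (h : IsPowEntry f b) :
    f ∈ teleSub K b.2.2 := by
  obtain ⟨a, ha, rfl⟩ := h
  exact teleSub_mono ha (derivSeq_pow_mem_teleSub _ _)

lemma mem_seqFil_of_isFracEntry_or_isPowEntry {f : ℕ → ℂ} {b : ℕ × ℕ × ℤ}
    (h : IsFracEntry f b ∨ IsPowEntry f b) : f ∈ seqFil K b.2.2 := by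
  rcases h with ⟨M, -, hM, -, rfl⟩ | ⟨a, ha, rfl⟩
  · exact derivSeq_mem_seqFil _ (ratGen_mem_ratFil (by simpa using hM))
  · exact derivSeq_mem_seqFil _ (ratGen_mem_ratFil (by simpa using ha))

lemma forall₂_mem_seqFil {L : List (ℕ → ℂ)} {q : List (ℕ × ℕ × ℤ)}
    (h : List.Forall₂ (fun f b => IsFracEntry f b ∨ IsPowEntry f b) L q) :
    List.Forall₂ (fun f d => f ∈ seqFil K d) L (q.map fun b => b.2.2) :=
  List.forall₂_map_right_iff.2 (h.imp fun _ _ => mem_seqFil_of_isFracEntry_or_isPowEntry)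

lemma ConvergesToMzvs.limIn_of_isEntry_succ (hn : ConvergesToMzvs K n) {L : List (ℕ → ℂ)}
    {q : List (ℕ × ℕ × ℤ)} (hq : q.length = n + 1) (hL : List.Forall₂ IsEntry L q)
    (hgood : DegGood 0 (q.map fun b => b.2.2)) :
    LimIn (mzvSpan K (q.map fun b => (b.1, b.2.1))) L := by
  refine LimIn.of_forall₂_span (K := K) q [] (fun L' hL' => ?_) L
    (hL.imp fun _ _ h => h.mem_span)
  clear hL
  obtain _ | @⟨f₀, b₀, L, q, hf₀, hL⟩ := hL'
  · simp at hq
  simp only [List.length_cons, Nat.add_right_cancel_iff] at hq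
  have hb₀ : (0 : ℤ) + b₀.2.2 + 1 ≤ -1 := hgood.1
  rw [List.nil_append]
  rcases forall₂_or_split hL with hL' | ⟨L₁, f, L₂, q₁, b, q₂, rfl, rfl, h₁, hf, h₂⟩
  · rcases hf₀ with ⟨M₀, -, hM₀, hA₀, rfl⟩ | ⟨a, ha, -⟩
    · refine LimIn.of_mem_span (pre := []) (fun f₀ hf₀ => ?_)
        (derivSeq_mem_span_of_two_le_card (by omega) hA₀)
      refine LimIn.of_forall₂_span (K := K) (G := fun b : ℕ × ℕ × ℤ =>
        powSeqs b.1 b.2.1 1 ∪ teleSub K (-2)) q [f₀] (fun L hL => ?_) L (hL'.imp ?_)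
      · exact hn.limIn_of_powSeqs_union_teleSub (b₀ := (b₀.1, b₀.2.1)) (by simpa using hq) hf₀
          (List.forall₂_map_right_iff.2 hL)
      · rintro f b ⟨M, h0, -, hA, rfl⟩
        exact derivSeq_mem_span_of_ne_zero h0 hA
    · omega
  · refine LimIn.mono (mzvSpanLE_le_mzvSpan (by simp [← hq])) (hn.limIn_teleSub
      (mem_seqFil_of_isFracEntry_or_isPowEntry hf₀) (forall₂_mem_seqFil h₁) hf.mem_teleSub
      (forall₂_mem_seqFil h₂) (by simpa using hgood) ?_)
    have := h₁.length_eq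
    have := h₂.length_eq
    simp only [List.length_append, List.length_cons] at hq
    omega

lemma exists_isEntry_of_forall₂_ratGens {L : List (ℕ → ℂ)} {ds : List ℤ}
    (h : List.Forall₂ (fun f d => f ∈ derivSeq 0 '' ratGens d) L ds) :
    ∃ q : List (ℕ × ℕ × ℤ), (q.map fun b => b.2.2) = ds ∧ List.Forall₂ IsEntry L q := by
  induction h with
  | nil => exact ⟨[], rfl, .nil⟩
  | @cons f d L ds h _ ih =>
    obtain ⟨_, ⟨a, M, ha, rfl⟩, rfl⟩ := h
    obtain ⟨q, rfl, hq⟩ := ih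
    exact ⟨(0, M.card, d) :: q, rfl,
      .cons ⟨a, M, ha, fun j => Multiset.count_le_card j M, rfl⟩ hq⟩

lemma limIn_nil (W : Submodule K ℂ) (h : (1 : ℂ) ∈ W) : LimIn W [] :=
  ⟨1, h, tendsto_const_nhds⟩

lemma convergesToMzvs (K : Subfield ℂ) (n : ℕ) : ConvergesToMzvs K n := by
  induction n with
  | zero =>
    intro L ds hL _ _
    rw [List.length_eq_zero_iff.1 hL]
    exact limIn_nil _ (by simpa using coe_mem_mzvSpanLE (1 : K) 0)
  | succ n ih =>
    intro L ds hLn hL hgood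
    refine LimIn.of_forall₂_span (K := K) (G := fun d => derivSeq 0 '' ratGens d) ds []
      (fun L hL' => ?_) L (hL.imp fun f d h => seqFil_le_span h)
    obtain ⟨q, rfl, hq⟩ := exists_isEntry_of_forall₂_ratGens hL'
    have hqn : q.length = n + 1 := by
      rw [← hLn, hL.length_eq, List.length_map]
    refine LimIn.mono ?_ (ih.limIn_of_isEntry_succ hqn hq hgood)
    simpa [hqn] using mzvSpan_le_mzvSpanLE (K := K) (q.map fun b => (b.1, b.2.1))

lemma limIn_of_isEntry {L : List (ℕ → ℂ)} {q : List (ℕ × ℕ × ℤ)} (hq : q ≠ [])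
    (hL : List.Forall₂ IsEntry L q) (hgood : DegGood 0 (q.map fun b => b.2.2)) :
    LimIn (mzvSpan K (q.map fun b => (b.1, b.2.1))) L :=
  (convergesToMzvs K (q.length - 1)).limIn_of_isEntry_succ
    (Nat.succ_pred_eq_of_ne_zero (by simpa using hq)).symm hL hgood

end Convergence

lemma foldr_pderivIter_eq {p : ℕ} {ι : Type*} (S : Finset ι) (c : ι → ℂ) (h : ι → Fin p → ℂ → ℂ)
    (hh : ∀ t i z, 0 < z.re → AnalyticAt ℂ (h t i) z) {F : (Fin p → ℂ) → ℂ}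
    (hF : ∀ k : Fin p → ℂ, (∀ i, 0 < (k i).re) → F k = ∑ t ∈ S, c t * ∏ i, h t i (k i))
    (l : Fin p → ℕ) (js : List (Fin p)) (hjs : js.Nodup) (k : Fin p → ℂ)
    (hk : ∀ i, 0 < (k i).re) :
    js.foldr (fun i g => pderivIter p i (l i) g) F k =
      ∑ t ∈ S, c t * ∏ i, iteratedDeriv (if i ∈ js then l i else 0) (h t i) (k i) := by
  induction js generalizing k with
  | nil => simpa using hF k hk
  | cons i js ih =>
    obtain ⟨hi, hjs⟩ := List.nodup_cons.1 hjs
    have hev : (fun z => js.foldr (fun i g => pderivIter p i (l i) g) F (Function.update k i z))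
        =ᶠ[𝓝 (k i)] fun z => ∑ t ∈ S, (c t * ∏ j ∈ Finset.univ.erase i,
          iteratedDeriv (if j ∈ i :: js then l j else 0) (h t j) (k j)) * h t i z := by
      filter_upwards [eventually_re_pos (hk i)] with z hz
      rw [ih hjs]
      · refine Finset.sum_congr rfl fun t _ => ?_
        rw [← Finset.mul_prod_erase _ _ (Finset.mem_univ i), Function.update_self, if_neg hi,
          iteratedDeriv_zero, mul_assoc, mul_comm (h t i z)]
        refine congrArg (fun w => c t * (w * h t i z)) (Finset.prod_congr rfl fun j hj => ?_)
        have hji := Finset.ne_of_mem_erase hj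
        rw [Function.update_of_ne hji]
        simp [hji]
      · intro j
        rcases eq_or_ne j i with rfl | hji
        · simpa using hz
        · simpa [hji] using hk j
    rw [List.foldr_cons, pderivIter, hev.iteratedDeriv_eq, iteratedDeriv_fun_sum]
    · refine Finset.sum_congr rfl fun t _ => ?_
      rw [iteratedDeriv_const_mul_field, mul_assoc, mul_comm (Finset.prod _ _),
        ← Finset.mul_prod_erase _ _ (Finset.mem_univ i), if_pos List.mem_cons_self]
    · exact fun t _ => (analyticAt_const.mul (hh t i _ (hk i))).contDiffAt

lemma pderivAll_eq_sum {p : ℕ} {ι : Type*} (S : Finset ι) (c : ι → ℂ) (h : ι → Fin p → ℂ → ℂ)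
    (hh : ∀ t i z, 0 < z.re → AnalyticAt ℂ (h t i) z) {F : (Fin p → ℂ) → ℂ}
    (hF : ∀ k : Fin p → ℂ, (∀ i, 0 < (k i).re) → F k = ∑ t ∈ S, c t * ∏ i, h t i (k i))
    (l : Fin p → ℕ) (k : Fin p → ℂ) (hk : ∀ i, 0 < (k i).re) :
    pderivAll p l F k = ∑ t ∈ S, c t * ∏ i, iteratedDeriv (l i) (h t i) (k i) := by
  have := foldr_pderivIter_eq S c h hh hF l (List.finRange p) (List.nodup_finRange p) k hk
  simp only [List.mem_finRange, if_true] at this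
  rw [pderivAll, List.ofFn_eq_map, List.foldr_map]
  exact this

/-- The multiset of the shifts occurring in the linear factors of `((z + r)_{n + 1}) ^ A`. -/
def poleShifts (A n r : ℕ) : Multiset ℕ := A • (Multiset.range (n + 1)).map (· + r)

lemma card_poleShifts (A n r : ℕ) : (poleShifts A n r).card = A * (n + 1) := by
  simp [poleShifts]

lemma count_poleShifts_le (A n r j : ℕ) : (poleShifts A n r).count j ≤ A := by
  rw [poleShifts, Multiset.count_nsmul]
  refine mul_le_of_le_one_right (Nat.zero_le A) (Multiset.nodup_iff_count_le_one.1 ?_ j)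
  exact (Multiset.nodup_range _).map (add_left_injective r)

lemma ascPochhammer_eval_eq_prod (n : ℕ) (z : ℂ) :
    (ascPochhammer ℂ n).eval z = ((Multiset.range n).map fun i : ℕ => z + i).prod := by
  induction n with
  | zero => simp
  | succ n ih =>
    rw [ascPochhammer_succ_eval, ih, Multiset.range_succ, Multiset.map_cons, Multiset.prod_cons,
      mul_comm]

lemma ratGen_poleShifts (a A n r : ℕ) (z : ℂ) :
    ratGen a (poleShifts A n r) z = z ^ a * ((ascPochhammer ℂ (n + 1)).eval (z + r) ^ A)⁻¹ := by
  rw [ratGen, poleShifts, Multiset.map_nsmul, Multiset.prod_nsmul, Multiset.map_map,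
    ascPochhammer_eval_eq_prod]
  refine congrArg (fun m : Multiset ℂ => z ^ a * (m.prod ^ A)⁻¹)
    (Multiset.map_congr rfl fun i _ => ?_)
  simp only [Function.comp_apply]
  push_cast
  ring

lemma Rfun_eq_sum (p : ℕ) (K : Subfield ℂ) (A n r : ℕ → ℕ) (P : MvPolynomial (Fin p) K)
    (k : Fin p → ℂ) :
    Rfun p K A n r P k = ∑ t ∈ P.support, ((P.coeff t : K) : ℂ) *
      ∏ i, ratGen (t i) (poleShifts (A i.1) (n i.1) (r i.1)) (k i) := by
  rw [Rfun, MvPolynomial.eval₂_eq', div_eq_mul_inv, Finset.sum_mul]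
  refine Finset.sum_congr rfl fun t _ => ?_
  simp only [ratGen_poleShifts, Finset.prod_mul_distrib, Finset.prod_inv_distrib, mul_assoc]
  rfl

lemma forall₂_ofFn {α β : Type*} {R : α → β → Prop} {p : ℕ} {f : Fin p → α} {g : Fin p → β}
    (h : ∀ i, R (f i) (g i)) : List.Forall₂ R (List.ofFn f) (List.ofFn g) := by
  induction p with
  | zero => simp
  | succ p ih =>
    rw [List.ofFn_succ, List.ofFn_succ]
    exact .cons (h 0) (ih fun i => h i.succ)

lemma degGood_ofFn {p : ℕ} {e : ℤ} {d : Fin p → ℤ}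
    (h : ∀ j, e + ∑ i ∈ Finset.Iic j, (d i + 1) ≤ -1) : DegGood e (List.ofFn d) := by
  induction p generalizing e with
  | zero => trivial
  | succ p ih =>
    simp only [← Finset.filter_ge_eq_Iic, Finset.sum_filter, Fin.sum_univ_succ] at h
    rw [List.ofFn_succ]
    refine ⟨by simpa [add_assoc] using h 0, ih fun j => ?_⟩
    rw [← Finset.filter_ge_eq_Iic, Finset.sum_filter]
    simpa [add_assoc] using h j.succ

lemma tsum_mem_of_hasSum_decomposition {p : ℕ} {K : Subfield ℂ} {W : Submodule K ℂ} {ι : Type*}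
    (S : Finset ι) (c : ι → K) (f : ι → Fin p → ℕ → ℂ)
    (hf : ∀ t ∈ S, LimIn W (List.ofFn (f t))) {G : (Fin p → ℕ) → ℂ}
    (hG : ∀ k : Fin p → ℕ, G (fun i => k i + 1) = ∑ t ∈ S, (c t : ℂ) * ∏ i, f t i (k i))
    (hconv : Summable fun k : {k : Fin p → ℕ // Antitone k ∧ ∀ i, 1 ≤ k i} => G k.1) :
    ∑' k : {k : Fin p → ℕ // Antitone k ∧ ∀ i, 1 ≤ k i}, G k.1 ∈ W := by
  have hR : ∀ k : Fin p → ℕ, Antitone k ↔ ∀ i j, i < j → k j < k i + 1 := fun k =>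
    antitone_iff_forall_lt.trans
      ⟨fun h i j hij => Nat.lt_succ_of_le (h hij), fun h i j hij => Nat.le_of_lt_succ (h i j hij)⟩
  have hlim := tendsto_sum_tupleSet hR G hconv
  choose! x hxW hx using hf
  have hlim' : Tendsto (fun N => ∑ t ∈ S, (c t : ℂ) * nestedSum 1 (List.ofFn (f t)) N) atTop
      (𝓝 (∑ t ∈ S, (c t : ℂ) * x t)) :=
    tendsto_finsetSum _ fun t ht => (hx t ht).const_mul _
  have heq : ∀ N, ∑ k ∈ tupleSet 1 p N, G (fun i => k i + 1) =
      ∑ t ∈ S, (c t : ℂ) * nestedSum 1 (List.ofFn (f t)) N := by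
    intro N
    simp only [hG, ← sum_tupleSet_prod le_rfl, Finset.mul_sum]
    exact Finset.sum_comm
  rw [tendsto_nhds_unique hlim (hlim'.congr fun N => (heq N).symm)]
  exact Submodule.sum_mem _ fun t ht => W.smul_mem (c t) (hxW t ht)

lemma exists_eq_sum_of_mem_mzvSpan {K : Subfield ℂ} {q : List (ℕ × ℕ)} {x : ℂ}
    (hx : x ∈ mzvSpan K q) :
    ∃ (T : Finset (List ℕ)) (c : List ℕ → K),
      (∀ s ∈ T, (∀ a ∈ s, 1 ≤ a) ∧ (s ≠ [] → 2 ≤ s.headI) ∧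
        (s.length < q.length ∨ List.Forall₂ (fun a b => 1 + b.1 ≤ a ∧ a ≤ b.2 + b.1) s q)) ∧
      x = ∑ s ∈ T, (c s : ℂ) * (mzv s : ℂ) := by
  obtain ⟨c, hc, rfl⟩ := (Finsupp.mem_span_image_iff_linearCombination K).1 hx
  exact ⟨c.support, c, fun s hs => hc hs, rfl⟩

theorem statement8 (p : ℕ) (hp : 0 < p) (A n r : ℕ → ℕ) (K : Subfield ℂ)
    (P : MvPolynomial (Fin p) K)
    (h9 : ∀ j : Fin p, (∑ i ∈ Finset.Iic j, P.degreeOf i) + j.1 + 2 ≤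
      ∑ i ∈ Finset.Iic j, A i.1 * (n i.1 + 1))
    (l : Fin p → ℕ)
    (hconv : Summable (fun k : {k : Fin p → ℕ // Antitone k ∧ ∀ i, 1 ≤ k i} =>
        pderivAll p l (Rfun p K A n r P) (fun i => (k.1 i : ℂ)))) :
    ∃ (T : Finset (List ℕ)) (c : List ℕ → K),
      (∀ s ∈ T, s.length ≤ p ∧ (∀ a ∈ s, 1 ≤ a) ∧ (s ≠ [] → 2 ≤ s.headI) ∧
        ∀ hs : s.length = p, ∀ i : Fin p,
          1 + l i ≤ s.get (Fin.cast hs.symm i) ∧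
            s.get (Fin.cast hs.symm i) ≤ A i.1 + l i) ∧
      (∑' k : {k : Fin p → ℕ // Antitone k ∧ ∀ i, 1 ≤ k i},
          pderivAll p l (Rfun p K A n r P) (fun i => (k.1 i : ℂ)))
        = ∑ s ∈ T, (c s : ℂ) * (mzv s : ℂ) := by
  set f : (Fin p →₀ ℕ) → Fin p → ℂ → ℂ := fun t i =>
    ratGen (t i) (poleShifts (A i.1) (n i.1) (r i.1))
  have hmem := tsum_mem_of_hasSum_decomposition
    (W := mzvSpan K (List.ofFn fun i : Fin p => (l i, A i.1)))
    P.support P.coeff (fun t i => derivSeq (l i) (f t i)) (fun t ht => ?_)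
    (G := fun k => pderivAll p l (Rfun p K A n r P) fun i => (k i : ℂ)) (fun k => ?_) hconv
  · obtain ⟨T, c, hT, hsum⟩ := exists_eq_sum_of_mem_mzvSpan hmem
    refine ⟨T, c, fun s hs => ?_, hsum⟩
    obtain ⟨h1, h2, h3⟩ := hT s hs
    refine ⟨?_, h1, h2, fun hsp i => ?_⟩
    · rcases h3 with h3 | h3
      · simpa using h3.le
      · simpa using h3.length_eq.le
    · rcases h3 with h3 | h3
      · simp [hsp] at h3
      · have := (List.forall₂_iff_get.1 h3).2 i.1 (by omega) (by simp)
        simpa using this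
  · set q : List (ℕ × ℕ × ℤ) :=
      List.ofFn fun i : Fin p => (l i, A i.1, (t i : ℤ) - (A i.1 * (n i.1 + 1) : ℕ))
    have hq : q.map (fun b => (b.1, b.2.1)) = List.ofFn fun i : Fin p => (l i, A i.1) := by
      simp only [q, List.map_ofFn]
      rfl
    rw [← hq]
    refine limIn_of_isEntry ?_ (forall₂_ofFn fun i => ?_) ?_
    · rw [ne_eq, ← List.length_eq_zero_iff, List.length_ofFn]
      exact hp.ne'
    · exact ⟨t i, _, by rw [card_poleShifts], count_poleShifts_le _ _ _, rfl⟩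
    · simp only [q, List.map_ofFn]
      refine degGood_ofFn fun j => ?_
      have h1 := h9 j
      have h2 : ∑ i ∈ Finset.Iic j, t i ≤ ∑ i ∈ Finset.Iic j, P.degreeOf i :=
        Finset.sum_le_sum fun i _ => MvPolynomial.monomial_le_degreeOf i ht
      simp only [Function.comp_apply, Finset.sum_add_distrib, Finset.sum_sub_distrib,
        Finset.sum_const, Fin.card_Iic, ← Nat.cast_sum]
      simp only [nsmul_eq_mul, mul_one]
      push_cast at h1 h2 ⊢
      zify at h1 h2
      linarith
  · rw [pderivAll_eq_sum P.support (fun t => ((P.coeff t : K) : ℂ)) f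
      (fun t i z hz => analyticAt_ratGen _ _ hz) (fun k _ => Rfun_eq_sum p K A n r P k)]
    · simp [derivSeq]
    · intro i
      push_cast
      exact natCast_add_one_re_pos (k i)
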